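/- arXiv:1805.11257 — 11 statements merged into one kernel-verified Lean document; each statement's English description precedes it below -/
import Mathlib

section
/- Let μ and ν be probability measures on a common measurable space. The map t ↦ S_t(μ‖ν) is convex, non-negative, and non-increasing on (0,1], with S_1(μ‖ν) = 0; moreover S_t(μ‖ν) = 0 if and only if t = 1 or μ = ν. -/
open MeasureTheory Real
open scoped ENNReal

/-- The mixture `t • μ + (1 - t) • ν`. -/
noncomputable abbrev skewMixture {α : Type*} [MeasurableSpace α] (μ ν : Measure α) (t : ℝ) :
    Measure α :=
  ENNReal.ofReal t • μ + ENNReal.ofReal (1 - t) • ν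

section SkewMixture

variable {α : Type*} [MeasurableSpace α] {μ ν : Measure α} {t : ℝ}

lemma absolutelyContinuous_skewMixture (ht : 0 < t) : μ ≪ skewMixture μ ν t :=
  (Measure.absolutelyContinuous_smul (by simpa using ht)).trans
    (Measure.AbsolutelyContinuous.rfl.add_right _)

lemma mixture_density_pos (ht : t ∈ Set.Ioc (0 : ℝ) 1) (x : α) :
    0 < t + (1 - t) * (ν.rnDeriv μ x).toReal :=
  add_pos_of_pos_of_nonneg ht.1 (mul_nonneg (sub_nonneg.2 ht.2) ENNReal.toReal_nonneg)

variable [IsProbabilityMeasure μ] [IsProbabilityMeasure ν]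

lemma isProbabilityMeasure_skewMixture (ht : t ∈ Set.Icc (0 : ℝ) 1) :
    IsProbabilityMeasure (skewMixture μ ν t) := by
  constructor
  simp only [Measure.add_apply, Measure.smul_apply, measure_univ, smul_eq_mul, mul_one]
  rw [← ENNReal.ofReal_add ht.1 (sub_nonneg.2 ht.2)]
  simp

/-- The log-likelihood ratio against the mixture, expressed through the density of `ν`
with respect to `μ`. -/
lemma llr_skewMixture (ht : t ∈ Set.Ioc (0 : ℝ) 1) :
    llr μ (skewMixture μ ν t) =ᵐ[μ] fun x ↦ -log (t + (1 - t) * (ν.rnDeriv μ x).toReal) := by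
  have := isProbabilityMeasure_skewMixture (μ := μ) (ν := ν) ⟨ht.1.le, ht.2⟩
  have : IsFiniteMeasure (ENNReal.ofReal t • μ) := μ.smul_finite ENNReal.ofReal_ne_top
  have : IsFiniteMeasure (ENNReal.ofReal (1 - t) • ν) := ν.smul_finite ENNReal.ofReal_ne_top
  filter_upwards [neg_llr (absolutelyContinuous_skewMixture (ν := ν) ht.1),
    Measure.rnDeriv_add (ENNReal.ofReal t • μ) (ENNReal.ofReal (1 - t) • ν) μ,
    Measure.rnDeriv_smul_left_of_ne_top μ μ (r := ENNReal.ofReal t) ENNReal.ofReal_ne_top,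
    Measure.rnDeriv_smul_left_of_ne_top ν μ (r := ENNReal.ofReal (1 - t)) ENNReal.ofReal_ne_top,
    Measure.rnDeriv_self μ, Measure.rnDeriv_lt_top ν μ] with x h₁ h₂ h₃ h₄ h₅ h₆
  rw [Pi.neg_apply] at h₁
  rw [← neg_neg (llr μ _ x), h₁, llr_def]
  beta_reduce
  simp only [Pi.add_apply, Pi.smul_apply, smul_eq_mul] at h₂ h₃ h₄
  rw [h₂, h₃, h₄, h₅, ENNReal.toReal_add (by finiteness)
    (ENNReal.mul_ne_top ENNReal.ofReal_ne_top h₆.ne)]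
  simp [ENNReal.toReal_ofReal, ht.1.le, ht.2]

lemma integrable_neg_log_mixture_density (ht : t ∈ Set.Ioc (0 : ℝ) 1) :
    Integrable (fun x ↦ -log (t + (1 - t) * (ν.rnDeriv μ x).toReal)) μ := by
  have hw : Integrable (fun x ↦ (ν.rnDeriv μ x).toReal) μ := Measure.integrable_toReal_rnDeriv
  refine integrable_of_le_of_le (g₁ := fun x ↦ 1 - (t + (1 - t) * (ν.rnDeriv μ x).toReal))
    (g₂ := fun _ ↦ -log t) (Measurable.aestronglyMeasurable (by fun_prop))
    (ae_of_all _ fun x ↦ ?_) (ae_of_all _ fun x ↦ ?_)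
    (by fun_prop) (integrable_const _)
  · have := log_le_sub_one_of_pos (mixture_density_pos (μ := μ) (ν := ν) ht x)
    linarith
  · refine neg_le_neg (log_le_log ht.1 ?_)
    linarith [mul_nonneg (sub_nonneg.2 ht.2) (ENNReal.toReal_nonneg (a := ν.rnDeriv μ x))]

lemma integral_llr_skewMixture (ht : t ∈ Set.Ioc (0 : ℝ) 1) :
    ∫ x, llr μ (skewMixture μ ν t) x ∂μ
      = ∫ x, -log (t + (1 - t) * (ν.rnDeriv μ x).toReal) ∂μ :=
  integral_congr_ae (llr_skewMixture ht)

lemma integral_llr_skewMixture_eq_toReal_klDiv (ht : t ∈ Set.Ioc (0 : ℝ) 1) :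
    ∫ x, llr μ (skewMixture μ ν t) x ∂μ
      = (InformationTheory.klDiv μ (skewMixture μ ν t)).toReal := by
  have := isProbabilityMeasure_skewMixture (μ := μ) (ν := ν) ⟨ht.1.le, ht.2⟩
  rw [InformationTheory.toReal_klDiv_of_measure_eq (absolutelyContinuous_skewMixture ht.1)
    (by simp only [measure_univ])]

lemma convexOn_integral_llr_skewMixture :
    ConvexOn ℝ (Set.Ioc (0 : ℝ) 1) fun t ↦ ∫ x, llr μ (skewMixture μ ν t) x ∂μ := by
  refine ⟨convex_Ioc 0 1, fun s hs t ht a b ha hb hab ↦ ?_⟩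
  have hst := convex_Ioc (0 : ℝ) 1 hs ht ha hb hab
  simp only [smul_eq_mul] at hst ⊢
  rw [integral_llr_skewMixture hs, integral_llr_skewMixture ht, integral_llr_skewMixture hst,
    ← integral_const_mul, ← integral_const_mul,
    ← integral_add ((integrable_neg_log_mixture_density hs).const_mul a)
      ((integrable_neg_log_mixture_density ht).const_mul b)]
  refine integral_mono (integrable_neg_log_mixture_density hst)
    (((integrable_neg_log_mixture_density hs).const_mul a).add
      ((integrable_neg_log_mixture_density ht).const_mul b)) fun x ↦ ?_
  have h := strictConcaveOn_log_Ioi.concaveOn.2 (mixture_density_pos (μ := μ) (ν := ν) hs x)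
    (mixture_density_pos (μ := μ) (ν := ν) ht x) ha hb hab
  simp only [smul_eq_mul] at h
  have heq : a * s + b * t + (1 - (a * s + b * t)) * (ν.rnDeriv μ x).toReal
      = a * (s + (1 - s) * (ν.rnDeriv μ x).toReal)
        + b * (t + (1 - t) * (ν.rnDeriv μ x).toReal) := by
    linear_combination -(ν.rnDeriv μ x).toReal * hab
  simp only [heq]
  linarith

lemma eq_skewMixture_iff (ht : t ∈ Set.Icc (0 : ℝ) 1) :
    μ = skewMixture μ ν t ↔ t = 1 ∨ μ = ν := by
  constructor
  · intro h
    refine or_iff_not_imp_left.2 fun h1 ↦ Measure.ext fun A _ ↦ ?_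
    have hA := congrArg (fun m : Measure α ↦ (m A).toReal) h
    simp only [Measure.add_apply, Measure.smul_apply, smul_eq_mul] at hA
    rw [ENNReal.toReal_add (by finiteness) (by finiteness), ENNReal.toReal_mul,
      ENNReal.toReal_mul, ENNReal.toReal_ofReal ht.1,
      ENNReal.toReal_ofReal (sub_nonneg.2 ht.2)] at hA
    refine (ENNReal.toReal_eq_toReal_iff' (measure_ne_top μ A) (measure_ne_top ν A)).1 ?_
    refine mul_left_cancel₀ (sub_ne_zero.2 (Ne.symm h1)) ?_
    linarith
  · rintro (rfl | rfl)
    · simp [skewMixture]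
    · rw [skewMixture, ← add_smul, ← ENNReal.ofReal_add ht.1 (sub_nonneg.2 ht.2)]
      simp

end SkewMixture

lemma ConvexOn.antitoneOn_of_isMinOn_right {f : ℝ → ℝ} {a b : ℝ}
    (hf : ConvexOn ℝ (Set.Ioc a b) f) (hb : IsMinOn f (Set.Ioc a b) b) :
    AntitoneOn f (Set.Ioc a b) := by
  intro s hs t ht hst
  have hbmem : b ∈ Set.Ioc a b := ⟨hs.1.trans_le hs.2, le_rfl⟩
  have h := hf.le_max_of_mem_Icc hs hbmem ⟨hst, ht.2⟩
  rwa [max_eq_left (hb hs)] at h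

/-- Proposition 3.3 (2),(4): for probability measures `μ`, `ν`, the map
`t ↦ S_t(μ‖ν) = D(μ ‖ t•μ + (1-t)•ν)` is convex, non-negative and non-increasing on `(0,1]`,
`S_1(μ‖ν) = 0`, and for `t ∈ (0,1]` one has `S_t(μ‖ν) = 0` iff `t = 1` or `μ = ν`. -/
theorem skew_relative_information_convex_antitone
    {α : Type*} [MeasurableSpace α] (μ ν : Measure α)
    [IsProbabilityMeasure μ] [IsProbabilityMeasure ν]
    (S : ℝ → ℝ)
    (hS : ∀ t, S t = ∫ x, llr μ (ENNReal.ofReal t • μ + ENNReal.ofReal (1 - t) • ν) x ∂μ) :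
    ConvexOn ℝ (Set.Ioc (0 : ℝ) 1) S ∧
    (∀ t ∈ Set.Ioc (0 : ℝ) 1, 0 ≤ S t) ∧
    AntitoneOn S (Set.Ioc (0 : ℝ) 1) ∧
    S 1 = 0 ∧
    (∀ t ∈ Set.Ioc (0 : ℝ) 1, (S t = 0 ↔ t = 1 ∨ μ = ν)) := by
  obtain rfl : S = fun t ↦ ∫ x, llr μ (skewMixture μ ν t) x ∂μ := funext hS
  have h1 : (1 : ℝ) ∈ Set.Ioc (0 : ℝ) 1 := ⟨one_pos, le_rfl⟩
  have hnonneg : ∀ t ∈ Set.Ioc (0 : ℝ) 1, 0 ≤ ∫ x, llr μ (skewMixture μ ν t) x ∂μ :=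
    fun t ht ↦ (integral_llr_skewMixture_eq_toReal_klDiv (μ := μ) (ν := ν) ht).symm ▸
      ENNReal.toReal_nonneg
  have hzero : ∀ t ∈ Set.Ioc (0 : ℝ) 1,
      (∫ x, llr μ (skewMixture μ ν t) x ∂μ = 0 ↔ t = 1 ∨ μ = ν) := by
    intro t ht
    have := isProbabilityMeasure_skewMixture (μ := μ) (ν := ν) ⟨ht.1.le, ht.2⟩
    rw [integral_llr_skewMixture_eq_toReal_klDiv ht, ENNReal.toReal_eq_zero_iff,
      or_iff_left (InformationTheory.klDiv_ne_top (absolutelyContinuous_skewMixture ht.1)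
        ((integrable_congr (llr_skewMixture ht)).2 (integrable_neg_log_mixture_density ht))),
      InformationTheory.klDiv_eq_zero_iff, eq_skewMixture_iff ⟨ht.1.le, ht.2⟩]
  have hone := (hzero 1 h1).2 (Or.inl rfl)
  have hconvex := convexOn_integral_llr_skewMixture (μ := μ) (ν := ν)
  exact ⟨hconvex, hnonneg,
    hconvex.antitoneOn_of_isMinOn_right fun t ht ↦ hone.le.trans (hnonneg t ht), hone, hzero⟩
end

section
/- Let f : [0,∞) → ℝ be convex with f(1) = 0 and let r, t ∈ [0,1]. Then the function f̂(x) = (tx + (1−t)) · f( (rx + (1−r)) / (tx + (1−t)) ), defined for x > 0 (and wherever tx + (1−t) > 0), is convex and satisfies f̂(1) = 0. Consequently, for probability measures μ, ν with densities u, v with respect to a common reference measure γ, the (r,t)-skew divergence D_f( rμ + (1−r)ν ‖ tμ + (1−t)ν ) equals the f-divergence D_{f̂}(μ‖ν); i.e., the class of f-divergences is stable under skewing. -/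
open MeasureTheory Real

/-- The perspective `(n, d) ↦ d * f (n / d)` of a convex function is convex along segments. -/
theorem ConvexOn.perspective_le {s : Set ℝ} {f : ℝ → ℝ} (hf : ConvexOn ℝ s f)
    {n₁ n₂ d₁ d₂ a b : ℝ} (hd₁ : 0 < d₁) (hd₂ : 0 < d₂) (hn₁ : n₁ / d₁ ∈ s) (hn₂ : n₂ / d₂ ∈ s)
    (ha : 0 ≤ a) (hb : 0 ≤ b) (hd : 0 < a * d₁ + b * d₂) :
    (a * d₁ + b * d₂) * f ((a * n₁ + b * n₂) / (a * d₁ + b * d₂)) ≤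
      a * (d₁ * f (n₁ / d₁)) + b * (d₂ * f (n₂ / d₂)) := by
  set d := a * d₁ + b * d₂ with hd_def
  have h := hf.2 hn₁ hn₂ (by positivity : 0 ≤ a * d₁ / d) (by positivity : 0 ≤ b * d₂ / d)
    (by rw [← add_div, ← hd_def, div_self hd.ne'])
  have harg : (a * d₁ / d) • (n₁ / d₁) + (b * d₂ / d) • (n₂ / d₂) = (a * n₁ + b * n₂) / d := by
    simp only [smul_eq_mul]
    field_simp
  rw [harg] at h
  calc d * f ((a * n₁ + b * n₂) / d)
      ≤ d * ((a * d₁ / d) • f (n₁ / d₁) + (b * d₂ / d) • f (n₂ / d₂)) :=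
        mul_le_mul_of_nonneg_left h hd.le
    _ = a * (d₁ * f (n₁ / d₁)) + b * (d₂ * f (n₂ / d₂)) := by
        simp only [smul_eq_mul]
        field_simp

/-- The function whose divergence is the `(r, t)`-skewing of the `f`-divergence is convex. -/
theorem ConvexOn.skew {f : ℝ → ℝ} (hf : ConvexOn ℝ (Set.Ici (0 : ℝ)) f) {r t : ℝ}
    (hr : r ∈ Set.Icc (0 : ℝ) 1) (ht : t ∈ Set.Icc (0 : ℝ) 1) :
    ConvexOn ℝ (Set.Ioi (0 : ℝ))
      (fun x => (t * x + (1 - t)) * f ((r * x + (1 - r)) / (t * x + (1 - t)))) := by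
  have hpos : ∀ {x : ℝ}, 0 < x → 0 < t * x + (1 - t) := by
    intro x hx
    rcases ht.1.eq_or_lt with rfl | h
    · norm_num
    · have := mul_pos h hx
      linarith [ht.2]
  have hmem : ∀ {x : ℝ}, 0 < x → (r * x + (1 - r)) / (t * x + (1 - t)) ∈ Set.Ici (0 : ℝ) :=
    fun hx => div_nonneg (add_nonneg (mul_nonneg hr.1 hx.le) (sub_nonneg.2 hr.2)) (hpos hx).le
  refine ⟨convex_Ioi 0, fun x hx y hy a b ha hb hab => ?_⟩
  have haffine : ∀ c : ℝ, c * (a * x + b * y) + (1 - c) =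
      a * (c * x + (1 - c)) + b * (c * y + (1 - c)) :=
    fun c => by linear_combination (c - 1) * hab
  have hd := hpos (convex_Ioi (0 : ℝ) hx hy ha hb hab)
  simp only [smul_eq_mul, haffine] at hd ⊢
  exact hf.perspective_le (hpos hx) (hpos hy) (hmem hx) (hmem hy) ha hb hd

/-- Theorem 3.5 (stability of f-divergences under skewing): if `f` is convex on `[0,∞)` with
`f 1 = 0` and `r, t ∈ [0,1]`, then `f̂ x = (t*x + (1-t)) * f ((r*x + (1-r)) / (t*x + (1-t)))`
is convex on `(0,∞)` with `f̂ 1 = 0`, and for probability densities `u`, `v` (with `v > 0`)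
with respect to a common reference measure `γ`,
`D_f(r•μ + (1-r)•ν ‖ t•μ + (1-t)•ν) = D_f̂(μ ‖ ν)`. -/
theorem skewing_preserves_f_divergence
    {α : Type*} [MeasurableSpace α] (γ : Measure α)
    (f : ℝ → ℝ) (hfconv : ConvexOn ℝ (Set.Ici (0 : ℝ)) f) (hf1 : f 1 = 0)
    {r t : ℝ} (hr : r ∈ Set.Icc (0 : ℝ) 1) (ht : t ∈ Set.Icc (0 : ℝ) 1)
    (u v : α → ℝ)
    (hu0 : ∀ x, 0 ≤ u x) (hv0 : ∀ x, 0 < v x)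
    (humeas : Measurable u) (hvmeas : Measurable v)
    (hu1 : ∫ x, u x ∂γ = 1) (hv1 : ∫ x, v x ∂γ = 1) :
    ConvexOn ℝ (Set.Ioi (0 : ℝ))
      (fun x => (t * x + (1 - t)) * f ((r * x + (1 - r)) / (t * x + (1 - t)))) ∧
    (t * 1 + (1 - t)) * f ((r * 1 + (1 - r)) / (t * 1 + (1 - t))) = 0 ∧
    ∫ x, f ((r * u x + (1 - r) * v x) / (t * u x + (1 - t) * v x))
          * (t * u x + (1 - t) * v x) ∂γ
      = ∫ x, ((t * (u x / v x) + (1 - t))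
          * f ((r * (u x / v x) + (1 - r)) / (t * (u x / v x) + (1 - t)))) * v x ∂γ := by
  refine ⟨hfconv.skew hr ht, by simp [hf1], integral_congr_ae (.of_forall fun x => ?_)⟩
  have hv := (hv0 x).ne'
  have hdiv : ∀ c : ℝ, c * (u x / v x) + (1 - c) = (c * u x + (1 - c) * v x) / v x :=
    fun c => by field_simp
  simp only [hdiv, div_div_div_cancel_right₀ hv]
  field_simp
end

section
/- For probability measures μ and ν on a common measurable space and t ∈ (0,1), the skew relative information is bounded by the skew chi-square divergence: S_t(μ‖ν) ≤ (1−t)² χ²_t(μ;ν). -/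
open MeasureTheory Real

/-- The pointwise form of the bound of the Kullback-Leibler divergence by the chi-square
divergence, for nonnegative reals with `a = 0` whenever `w = 0`. -/
lemma mul_log_div_le_sq_sub_div_add_sub {a w : ℝ} (ha : 0 ≤ a) (hw : 0 ≤ w) (h : w = 0 → a = 0) :
    a * Real.log (a / w) ≤ (a - w) ^ 2 / w + (a - w) := by
  rcases hw.eq_or_lt with rfl | hw
  · simp [h rfl]
  rcases ha.eq_or_lt with rfl | ha
  · have : (0 - w) ^ 2 / w + (0 - w) = 0 := by field_simp; ring
    rw [this, zero_mul]
  · calc a * Real.log (a / w) ≤ a * (a / w - 1) := by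
          gcongr
          exact Real.log_le_sub_one_of_pos (div_pos ha hw)
      _ = (a - w) ^ 2 / w + (a - w) := by field_simp; ring

/-- Theorem 3.9, inequality (3.10): for probability densities `u`, `v` with respect to `γ`
and `t ∈ (0,1)`, the skew relative information is bounded by the skew chi-square divergence:
`S_t(μ‖ν) = ∫ u log (u/(t*u+(1-t)*v)) dγ ≤ (1-t)² ∫ (u-v)²/(t*u+(1-t)*v) dγ = (1-t)² χ²_t(μ;ν)`. -/
theorem skew_relative_information_le_skew_chi_square
    {α : Type*} [MeasurableSpace α] (γ : Measure α)
    (u v : α → ℝ)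
    (hu0 : ∀ x, 0 ≤ u x) (hv0 : ∀ x, 0 ≤ v x)
    (humeas : Measurable u) (hvmeas : Measurable v)
    (hu1 : ∫ x, u x ∂γ = 1) (hv1 : ∫ x, v x ∂γ = 1)
    {t : ℝ} (ht : t ∈ Set.Ioo (0 : ℝ) 1)
    (hSint : Integrable (fun x => u x * Real.log (u x / (t * u x + (1 - t) * v x))) γ)
    (hχint : Integrable (fun x => (u x - v x) ^ 2 / (t * u x + (1 - t) * v x)) γ) :
    ∫ x, u x * Real.log (u x / (t * u x + (1 - t) * v x)) ∂γ
      ≤ (1 - t) ^ 2 * ∫ x, (u x - v x) ^ 2 / (t * u x + (1 - t) * v x) ∂γ := by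
  obtain ⟨ht0, ht1⟩ := ht
  have hui : Integrable u γ := .of_integral_ne_zero (by simp [hu1])
  have hvi : Integrable v γ := .of_integral_ne_zero (by simp [hv1])
  have hpoint (x : α) : u x * Real.log (u x / (t * u x + (1 - t) * v x)) ≤
      (1 - t) ^ 2 * ((u x - v x) ^ 2 / (t * u x + (1 - t) * v x)) + (1 - t) * (u x - v x) := by
    have hu := mul_nonneg ht0.le (hu0 x)
    have hv := mul_nonneg (sub_pos.2 ht1).le (hv0 x)
    have hzero : t * u x + (1 - t) * v x = 0 → u x = 0 := fun h ↦
      (mul_eq_zero.1 (by linarith : t * u x = 0)).resolve_left ht0.ne'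
    have hsub : u x - (t * u x + (1 - t) * v x) = (1 - t) * (u x - v x) := by ring
    have key := mul_log_div_le_sq_sub_div_add_sub (hu0 x) (add_nonneg hu hv) hzero
    rwa [hsub, mul_pow, mul_div_assoc] at key
  have hχi := hχint.const_mul ((1 - t) ^ 2)
  have hdi := (hui.sub hvi).const_mul (1 - t)
  refine (integral_mono hSint (hχi.add hdi) hpoint).trans_eq ?_
  simp only [Pi.add_apply, Pi.sub_apply] at hdi ⊢
  rw [integral_add hχi hdi, integral_const_mul, integral_const_mul, integral_sub hui hvi, hu1, hv1]
  ring
end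

section
/- For probability measures μ and ν on a common measurable space, the function t ↦ S_t(μ‖ν) is differentiable on (0,1) and satisfies the differential identity d/dt S_t(μ‖ν) = (t − 1) χ²_t(μ;ν). -/
open MeasureTheory Real

theorem hasDerivAt_mul_log_div_convexCombination {a b s : ℝ} (ha : 0 ≤ a) (hb : 0 ≤ b)
    (hs : s ∈ Set.Ioo (0 : ℝ) 1) :
    HasDerivAt (fun r => a * Real.log (a / (r * a + (1 - r) * b)))
      (-(a * (a - b) / (s * a + (1 - s) * b))) s := by
  rcases ha.eq_or_lt with rfl | ha
  · simpa using hasDerivAt_const s (0 : ℝ)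
  have hm : 0 < s * a + (1 - s) * b :=
    add_pos_of_pos_of_nonneg (mul_pos hs.1 ha) (mul_nonneg (sub_nonneg.2 hs.2.le) hb)
  have hd : HasDerivAt (fun r => r * a + (1 - r) * b) (a - b) s := by
    exact (((hasDerivAt_id' s).mul_const a).add
      (((hasDerivAt_id' s).const_sub 1).mul_const b)).congr_deriv (by ring)
  have hdiv := (hasDerivAt_const s a).div hd hm.ne'
  refine ((hdiv.log (div_pos ha hm).ne').const_mul a).congr_deriv ?_
  simp only [Pi.div_apply]
  field_simp
  ring

theorem abs_mul_sub_div_convexCombination_le {a b s : ℝ} (ha : 0 ≤ a) (hb : 0 ≤ b)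
    (hs : s ∈ Set.Ioo (0 : ℝ) 1) :
    |a * (a - b) / (s * a + (1 - s) * b)| ≤ |a - b| / s := by
  have hsb : 0 ≤ (1 - s) * b := mul_nonneg (sub_nonneg.2 hs.2.le) hb
  have hm : 0 ≤ s * a + (1 - s) * b := add_nonneg (mul_nonneg hs.1.le ha) hsb
  rw [abs_div, abs_mul, abs_of_nonneg ha, abs_of_nonneg hm]
  refine div_le_of_le_mul₀ hm (by have := hs.1; positivity) ?_
  rw [div_mul_eq_mul_div, le_div_iff₀ hs.1]
  nlinarith [mul_nonneg (abs_nonneg (a - b)) hsb]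

theorem mul_sub_div_convexCombination_eq {a b t : ℝ} (ha : 0 ≤ a) (hb : 0 ≤ b)
    (ht : t ∈ Set.Ioo (0 : ℝ) 1) :
    -(a * (a - b) / (t * a + (1 - t) * b)) =
      (t - 1) * ((a - b) ^ 2 / (t * a + (1 - t) * b)) - (a - b) := by
  rcases eq_or_ne (t * a + (1 - t) * b) 0 with hm | hm
  · have h1 : 0 ≤ t * a := mul_nonneg ht.1.le ha
    have h2 : 0 ≤ (1 - t) * b := mul_nonneg (sub_nonneg.2 ht.2.le) hb
    have ha0 : a = 0 := (mul_eq_zero.1 (by linarith : t * a = 0)).resolve_left ht.1.ne'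
    have hb0 : b = 0 :=
      (mul_eq_zero.1 (by linarith : (1 - t) * b = 0)).resolve_left (sub_pos.2 ht.2).ne'
    simp [ha0, hb0]
  · rw [← neg_div, ← mul_div_assoc, div_sub' hm, div_left_inj' hm]
    ring

/-- Theorem 3.9, identity (3.11): for probability densities `u`, `v` with respect to `γ`,
the map `t ↦ S_t(μ‖ν) = ∫ u log (u/(t*u+(1-t)*v)) dγ` is differentiable on `(0,1)` with
`d/dt S_t(μ‖ν) = (t-1) * χ²_t(μ;ν) = (t-1) * ∫ (u-v)²/(t*u+(1-t)*v) dγ`. -/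
theorem skew_relative_information_hasDerivAt
    {α : Type*} [MeasurableSpace α] (γ : Measure α)
    (u v : α → ℝ)
    (hu0 : ∀ x, 0 ≤ u x) (hv0 : ∀ x, 0 ≤ v x)
    (humeas : Measurable u) (hvmeas : Measurable v)
    (hu1 : ∫ x, u x ∂γ = 1) (hv1 : ∫ x, v x ∂γ = 1)
    (hSint : ∀ s ∈ Set.Ioo (0 : ℝ) 1,
      Integrable (fun x => u x * Real.log (u x / (s * u x + (1 - s) * v x))) γ)
    (hχint : ∀ s ∈ Set.Ioo (0 : ℝ) 1,
      Integrable (fun x => (u x - v x) ^ 2 / (s * u x + (1 - s) * v x)) γ) :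
    ∀ t ∈ Set.Ioo (0 : ℝ) 1,
      HasDerivAt (fun s => ∫ x, u x * Real.log (u x / (s * u x + (1 - s) * v x)) ∂γ)
        ((t - 1) * ∫ x, (u x - v x) ^ 2 / (t * u x + (1 - t) * v x) ∂γ) t := by
  intro t ht
  have hui : Integrable u γ := .of_integral_ne_zero (by simp [hu1])
  have hvi : Integrable v γ := .of_integral_ne_zero (by simp [hv1])
  have hsub : Integrable (fun x => u x - v x) γ := hui.sub hvi
  have hlt : t / 2 < t := half_lt_self ht.1
  have hderiv := (hasDerivAt_integral_of_dominated_loc_of_deriv_le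
    (F := fun s x => u x * Real.log (u x / (s * u x + (1 - s) * v x)))
    (F' := fun s x => -(u x * (u x - v x) / (s * u x + (1 - s) * v x)))
    (bound := fun x => |u x - v x| / (t / 2)) (Ioo_mem_nhds hlt ht.2)
    (.of_forall fun s => by fun_prop) (hSint t ht)
    (Measurable.aestronglyMeasurable (by fun_prop))
    (.of_forall fun x s hs => ?_) (hsub.abs.div_const _)
    (.of_forall fun x s hs => hasDerivAt_mul_log_div_convexCombination (hu0 x) (hv0 x)
      ⟨(half_pos ht.1).trans hs.1, hs.2⟩)).2
  · refine hderiv.congr_deriv ?_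
    simp_rw [fun x => mul_sub_div_convexCombination_eq (hu0 x) (hv0 x) ht]
    rw [integral_sub ((hχint t ht).const_mul _) hsub, integral_const_mul,
      integral_sub hui hvi, hu1, hv1, sub_self, sub_zero]
  · rw [norm_neg, Real.norm_eq_abs]
    refine (abs_mul_sub_div_convexCombination_le (hu0 x) (hv0 x)
      ⟨(half_pos ht.1).trans hs.1, hs.2⟩).trans ?_
    exact div_le_div_of_nonneg_left (abs_nonneg _) (half_pos ht.1) hs.1.le
end

section
/- For probability measures μ and ν on a common measurable space and t ∈ (0,1), the skew relative information is bounded by the total variation distance: S_t(μ‖ν) ≤ (−log t) · ‖μ − ν‖_TV. -/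
open MeasureTheory Real

/-- Pointwise bound behind the total variation estimate, from concavity of `log` on the segment
joining `t` to `1`. -/
theorem mul_log_div_skew_le {a b t : ℝ} (ha : 0 ≤ a) (hb : 0 ≤ b) (ht : t ∈ Set.Ioo (0 : ℝ) 1) :
    a * Real.log (a / (t * a + (1 - t) * b)) ≤ -Real.log t * max (a - b) 0 := by
  obtain ⟨ht0, ht1⟩ := ht
  have hL : 0 ≤ -Real.log t := by linarith [Real.log_neg ht0 ht1]
  rcases ha.eq_or_lt with rfl | ha
  · simpa using mul_nonneg hL (le_max_right (0 - b) 0)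
  have hc : 0 < t * a + (1 - t) * b :=
    add_pos_of_pos_of_nonneg (mul_pos ht0 ha) (mul_nonneg (by linarith) hb)
  rcases le_total a b with hab | hab
  · rw [max_eq_right (by linarith), mul_zero]
    refine mul_nonpos_of_nonneg_of_nonpos ha.le (Real.log_nonpos (by positivity) ?_)
    rw [div_le_one hc]
    nlinarith
  · rw [max_eq_left (by linarith)]
    have hba : b / a ≤ 1 := (div_le_one ha).2 hab
    have hconc := strictConcaveOn_log_Ioi.concaveOn.2 (Set.mem_Ioi.2 one_pos) (Set.mem_Ioi.2 ht0)
      (div_nonneg hb ha.le) (sub_nonneg.2 hba) (by ring)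
    simp only [smul_eq_mul, Real.log_one, mul_zero, zero_add] at hconc
    have hinv : a / (t * a + (1 - t) * b) = (b / a * 1 + (1 - b / a) * t)⁻¹ := by
      rw [show b / a * 1 + (1 - b / a) * t = (t * a + (1 - t) * b) / a by field_simp; ring,
        inv_div]
    rw [hinv, Real.log_inv]
    calc a * -Real.log (b / a * 1 + (1 - b / a) * t)
        ≤ a * -((1 - b / a) * Real.log t) := by gcongr
      _ = -Real.log t * (a - b) := by field_simp

/-- For integrable `f` with zero mean, the positive part carries half of the `L¹` mass. -/
theorem integral_max_zero_eq_half_integral_abs {α : Type*} [MeasurableSpace α] {γ : Measure α}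
    {f : α → ℝ} (hf : Integrable f γ) (hf0 : ∫ x, f x ∂γ = 0) :
    ∫ x, max (f x) 0 ∂γ = 1 / 2 * ∫ x, |f x| ∂γ := by
  have h : ∀ x, max (f x) 0 = 1 / 2 * (|f x| + f x) := fun x => by
    rcases le_total 0 (f x) with hx | hx
    · rw [max_eq_left hx, abs_of_nonneg hx]; ring
    · rw [max_eq_right hx, abs_of_nonpos hx]; ring
  simp_rw [h]
  rw [integral_const_mul, integral_add hf.abs hf, hf0, add_zero]

/-- Theorem 3.10, inequality (3.13): for probability densities `u`, `v` with respect to `γ`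
and `t ∈ (0,1)`, the skew relative information is bounded by total variation:
`S_t(μ‖ν) = ∫ u log (u/(t*u+(1-t)*v)) dγ ≤ (-log t) * ‖μ-ν‖_TV`,
where `‖μ-ν‖_TV = (1/2) ∫ |u - v| dγ`. -/
theorem skew_relative_information_le_tv
    {α : Type*} [MeasurableSpace α] (γ : Measure α)
    (u v : α → ℝ)
    (hu0 : ∀ x, 0 ≤ u x) (hv0 : ∀ x, 0 ≤ v x)
    (humeas : Measurable u) (hvmeas : Measurable v)
    (hu1 : ∫ x, u x ∂γ = 1) (hv1 : ∫ x, v x ∂γ = 1)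
    {t : ℝ} (ht : t ∈ Set.Ioo (0 : ℝ) 1)
    (hSint : Integrable (fun x => u x * Real.log (u x / (t * u x + (1 - t) * v x))) γ)
    (htvint : Integrable (fun x => |u x - v x|) γ) :
    ∫ x, u x * Real.log (u x / (t * u x + (1 - t) * v x)) ∂γ
      ≤ (- Real.log t) * ((1 / 2) * ∫ x, |u x - v x| ∂γ) := by
  have hu : Integrable u γ := Integrable.of_integral_ne_zero (by simp [hu1])
  have hv : Integrable v γ := Integrable.of_integral_ne_zero (by simp [hv1])
  have huv : Integrable (fun x => u x - v x) γ := hu.sub hv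
  have huv0 : ∫ x, u x - v x ∂γ = 0 := by rw [integral_sub hu hv, hu1, hv1, sub_self]
  rw [← integral_max_zero_eq_half_integral_abs huv huv0, ← integral_const_mul]
  exact integral_mono hSint (huv.pos_part.const_mul _)
    fun x => mul_log_div_skew_le (hu0 x) (hv0 x) ht
end

section
/- (Reverse Pinsker inequality.) Let μ and γ be probability measures such that μ is absolutely continuous with respect to γ with dμ/dγ ≤ 1/β for some β ∈ (0,1). Then ‖μ − γ‖_TV ≥ ((1 − β)/log(1/β)) · D(μ‖γ). -/
open MeasureTheory Real

/-- The chord bound for the convex function `v * log v` on `[1, 1 / β]`, extended to `[0, 1 / β]`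
by replacing `v - 1` with its positive part. -/
lemma mul_log_le_posPart_of_le_one_div {β v : ℝ} (hβ : β ∈ Set.Ioo (0 : ℝ) 1)
    (hv0 : 0 ≤ v) (hv : v ≤ 1 / β) :
    ((1 - β) / Real.log (1 / β)) * (v * Real.log v) ≤ (1 / 2) * (|v - 1| + (v - 1)) := by
  obtain ⟨hβ0, hβ1⟩ := hβ
  have hL : 0 < Real.log (1 / β) := Real.log_pos ((one_lt_div hβ0).2 hβ1)
  have hc : 0 < 1 - β := sub_pos.2 hβ1
  rcases le_total v 1 with h | h
  · rw [abs_of_nonpos (by linarith)]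
    have := mul_nonpos_of_nonneg_of_nonpos (div_pos hc hL).le
      (Real.mul_log_nonpos hv0 h)
    linarith
  · rw [abs_of_nonneg (by linarith)]
    have hvβ : v * β ≤ 1 := (le_div_iff₀ hβ0).1 hv
    have hconv := Real.convexOn_mul_log.2 (Set.mem_Ici.2 zero_le_one)
      (Set.mem_Ici.2 (one_div_pos.2 hβ0).le)
      (show 0 ≤ (1 - v * β) / (1 - β) from div_nonneg (by linarith) hc.le)
      (show 0 ≤ (v - 1) * β / (1 - β) from
        div_nonneg (mul_nonneg (by linarith) hβ0.le) hc.le)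
      (by field_simp; ring)
    have hcomb : (1 - v * β) / (1 - β) * 1 + (v - 1) * β / (1 - β) * (1 / β) = v := by
      field_simp
      ring
    have hchord : (v - 1) * β / (1 - β) * (1 / β * Real.log (1 / β))
        = (v - 1) * Real.log (1 / β) / (1 - β) := by
      field_simp
    simp only [smul_eq_mul, hcomb, hchord, Real.log_one, mul_zero, zero_add] at hconv
    rw [le_div_iff₀ hc] at hconv
    rw [div_mul_eq_mul_div, div_le_iff₀ hL]
    linarith

/-- Corollary 3.11 (reverse Pinsker inequality, Verdú): if `μ` has density `u = dμ/dγ ≤ 1/β`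
(a.e.) with respect to the probability measure `γ`, with `β ∈ (0,1)`, then
`‖μ - γ‖_TV = (1/2) ∫ |u - 1| dγ ≥ ((1-β)/log(1/β)) * D(μ‖γ)`,
where `D(μ‖γ) = ∫ u log u dγ`. -/
theorem reverse_pinsker
    {α : Type*} [MeasurableSpace α] (γ : Measure α) [IsProbabilityMeasure γ]
    (u : α → ℝ)
    (hu0 : ∀ x, 0 ≤ u x) (humeas : Measurable u) (hu1 : ∫ x, u x ∂γ = 1)
    {β : ℝ} (hβ : β ∈ Set.Ioo (0 : ℝ) 1)
    (hbound : ∀ᵐ x ∂γ, u x ≤ 1 / β)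
    (hDint : Integrable (fun x => u x * Real.log (u x)) γ) :
    ((1 - β) / Real.log (1 / β)) * ∫ x, u x * Real.log (u x) ∂γ
      ≤ (1 / 2) * ∫ x, |u x - 1| ∂γ := by
  have hu : Integrable u γ := .of_integral_ne_zero (by simp [hu1])
  have hsub : Integrable (fun x => u x - 1) γ := hu.sub (integrable_const 1)
  have hsub0 : ∫ x, (u x - 1) ∂γ = 0 := by
    rw [integral_sub hu (integrable_const 1), hu1]
    simp
  calc ((1 - β) / Real.log (1 / β)) * ∫ x, u x * Real.log (u x) ∂γ
      = ∫ x, ((1 - β) / Real.log (1 / β)) * (u x * Real.log (u x)) ∂γ :=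
        (integral_const_mul _ _).symm
    _ ≤ ∫ x, (1 / 2) * (|u x - 1| + (u x - 1)) ∂γ := by
        refine integral_mono_ae (hDint.const_mul _) ((hsub.abs.add hsub).const_mul _) ?_
        filter_upwards [hbound] with x hx
        exact mul_log_le_posPart_of_le_one_div hβ (hu0 x) hx
    _ = (1 / 2) * ∫ x, |u x - 1| ∂γ := by
        rw [integral_const_mul, integral_add hsub.abs hsub, hsub0, add_zero]
end

section
/- For probability measures μ and ν on a common measurable space, the Jensen–Shannon divergence is bounded by the total variation distance: JSD(μ‖ν) ≤ ‖μ − ν‖_TV · log 2. -/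
open MeasureTheory Real

lemma mul_log_div_eq_sub {a m : ℝ} (hm : m ≠ 0) :
    a * log (a / m) = a * log a - a * log m := by
  rcases eq_or_ne a 0 with rfl | ha
  · simp
  · rw [log_div ha hm, mul_sub]

lemma mul_log_div_midpoint_add_le_of_le {a b : ℝ} (hb : 0 ≤ b) (hab : b ≤ a) :
    a * log (a / ((a + b) / 2)) + b * log (b / ((a + b) / 2)) ≤ (a - b) * log 2 := by
  rcases (add_nonneg (hb.trans hab) hb).eq_or_lt with hs | hs
  · obtain rfl : a = 0 := by linarith
    obtain rfl : b = 0 := by linarith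
    simp
  have hm : (0 : ℝ) < (a + b) / 2 := by positivity
  have hw₁ : 0 ≤ (a - b) / (a + b) := div_nonneg (sub_nonneg.2 hab) hs.le
  have hw₂ : 0 ≤ 2 * b / (a + b) := by positivity
  have hw : (a - b) / (a + b) + 2 * b / (a + b) = 1 := by field_simp; ring
  have ha := convexOn_mul_log.2 (Set.mem_Ici.2 hs.le) (Set.mem_Ici.2 hm.le) hw₁ hw₂ hw
  have hb' := convexOn_mul_log.2 (Set.mem_Ici.2 le_rfl) (Set.mem_Ici.2 hm.le) hw₁ hw₂ hw
  simp only [smul_eq_mul] at ha hb'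
  have e₁ : (a - b) / (a + b) * (a + b) = a - b := by field_simp
  have e₂ : 2 * b / (a + b) * ((a + b) / 2) = b := by field_simp
  simp only [← mul_assoc, e₁, e₂, sub_add_cancel, mul_zero, zero_mul, zero_add] at ha hb'
  rw [mul_log_div_eq_sub hm.ne', mul_log_div_eq_sub hm.ne']
  rw [log_div hs.ne' two_ne_zero] at *
  linarith

/-- The integrand of Lin's bound on the Jensen–Shannon divergence. -/
lemma mul_log_div_midpoint_add_le {a b : ℝ} (ha : 0 ≤ a) (hb : 0 ≤ b) :
    a * log (a / ((a + b) / 2)) + b * log (b / ((a + b) / 2)) ≤ |a - b| * log 2 := by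
  rcases le_total b a with h | h
  · rw [abs_of_nonneg (sub_nonneg.2 h)]
    exact mul_log_div_midpoint_add_le_of_le hb h
  · rw [abs_sub_comm, abs_of_nonneg (sub_nonneg.2 h), add_comm a b, add_comm (a * _)]
    exact mul_log_div_midpoint_add_le_of_le ha h

/-- Corollary 3.13 (Lin's bound): for probability densities `u`, `v` with respect to `γ`,
the Jensen–Shannon divergence
`JSD(μ‖ν) = (1/2) D(μ ‖ (μ+ν)/2) + (1/2) D(ν ‖ (μ+ν)/2)` is bounded by
`‖μ-ν‖_TV * log 2`, where `‖μ-ν‖_TV = (1/2) ∫ |u - v| dγ`. -/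
theorem jensen_shannon_le_tv_mul_log_two
    {α : Type*} [MeasurableSpace α] (γ : Measure α)
    (u v : α → ℝ)
    (hu0 : ∀ x, 0 ≤ u x) (hv0 : ∀ x, 0 ≤ v x)
    (humeas : Measurable u) (hvmeas : Measurable v)
    (hu1 : ∫ x, u x ∂γ = 1) (hv1 : ∫ x, v x ∂γ = 1)
    (hint1 : Integrable (fun x => u x * Real.log (u x / ((u x + v x) / 2))) γ)
    (hint2 : Integrable (fun x => v x * Real.log (v x / ((u x + v x) / 2))) γ)
    (htvint : Integrable (fun x => |u x - v x|) γ) :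
    (1 / 2) * (∫ x, u x * Real.log (u x / ((u x + v x) / 2)) ∂γ)
        + (1 / 2) * (∫ x, v x * Real.log (v x / ((u x + v x) / 2)) ∂γ)
      ≤ ((1 / 2) * ∫ x, |u x - v x| ∂γ) * Real.log 2 := by
  have h := integral_mono (hint1.add hint2) (htvint.mul_const (log 2))
    fun x => mul_log_div_midpoint_add_le (hu0 x) (hv0 x)
  simp only [Pi.add_apply] at h
  rw [integral_add hint1 hint2, integral_mul_const] at h
  linarith
end

section
/- Let φ be a probability density on ℝ^d of the form φ(x) = ψ(|x|) with ψ : [0,∞) → [0,∞) non-increasing, let λ > 0, and let 𝒳 ⊆ ℝ^d be a discrete set admitting a partition 𝒳_1, …, 𝒳_M such that any two distinct points in the same part are at Euclidean distance at least 2λ. Then ∑_{x ∈ 𝒳} φ(x) ≤ M ( ‖φ‖_∞ + (3/λ)^d ω_d^{−1} ), where ω_d is the Lebesgue volume of the d-dimensional unit ball. In particular, the same bound holds whenever every x_0 ∈ 𝒳 satisfies #{x ∈ 𝒳 : |x − x_0| < 2λ} ≤ M. -/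
open MeasureTheory Metric Set

section BoundedOverlap

variable {E : Type*} [NormedAddCommGroup E] [NormedSpace ℝ E]

/-- The ball of radius `r / 2` obtained from `ball x r` by shrinking it and pushing it towards the
origin lies in `ball x r` and in the ball around the origin on whose boundary `x` lies. -/
lemma norm_le_and_dist_lt_of_mem_shifted_ball {x y : E} {r : ℝ} (hr : 0 < r) (hx : r ≤ ‖x‖)
    (hy : y ∈ ball ((1 - r / (2 * ‖x‖)) • x) (r / 2)) : ‖y‖ ≤ ‖x‖ ∧ dist x y < r := by
  have hx0 : 0 < ‖x‖ := hr.trans_le hx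
  set c := (1 - r / (2 * ‖x‖)) • x with hc
  have hquot : r / (2 * ‖x‖) ≤ 1 := by
    rw [div_le_one (by positivity)]
    linarith
  have hcn : ‖c‖ = ‖x‖ - r / 2 := by
    rw [hc, norm_smul, Real.norm_of_nonneg (by linarith)]
    field_simp
  have hxc : dist x c = r / 2 := by
    have : x - c = (r / (2 * ‖x‖)) • x := by
      rw [hc, sub_smul, one_smul, sub_sub_cancel]
    rw [dist_eq_norm, this, norm_smul, Real.norm_of_nonneg (by positivity)]
    field_simp
  rw [mem_ball] at hy
  constructor
  · have := norm_le_norm_add_norm_sub' y c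
    rw [dist_eq_norm] at hy
    linarith
  · have := dist_triangle_right x y c
    linarith

variable [FiniteDimensional ℝ E] [MeasurableSpace E] [BorelSpace E]
  (μ : Measure E) [μ.IsAddHaarMeasure]

/-- The sum of a radially non-increasing integrable function over points at distance at least `r`
from the origin, no point of the space being within `r` of more than `M` of them. -/
lemma sum_mul_measureReal_ball_le_of_overlap {φ : E → ℝ} (hφ0 : ∀ x, 0 ≤ φ x)
    (hφ : ∀ x y, ‖y‖ ≤ ‖x‖ → φ x ≤ φ y) (hint : Integrable φ μ)
    {r : ℝ} (hr : 0 < r) {M : ℕ} {s : Finset E} (hs : ∀ x ∈ s, r ≤ ‖x‖)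
    (hM : ∀ z, (s.filter fun x => dist x z < r).card ≤ M) :
    (∑ x ∈ s, φ x) * ((r / 2) ^ Module.finrank ℝ E * μ.real (ball 0 1)) ≤ M * ∫ x, φ x ∂μ := by
  set B : E → Set E := fun x => ball ((1 - r / (2 * ‖x‖)) • x) (r / 2) with hB
  have hind (x : E) : Integrable ((B x).indicator φ) μ := hint.indicator measurableSet_ball
  calc (∑ x ∈ s, φ x) * ((r / 2) ^ Module.finrank ℝ E * μ.real (ball 0 1))
      = ∑ x ∈ s, φ x * μ.real (B x) := by
        rw [Finset.sum_mul]
        refine Finset.sum_congr rfl fun x _ => ?_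
        rw [hB, measureReal_def, measureReal_def,
          Measure.addHaar_ball_of_pos μ ((1 - r / (2 * ‖x‖)) • x) (half_pos hr),
          ENNReal.toReal_mul, ENNReal.toReal_ofReal (by positivity)]
    _ ≤ ∑ x ∈ s, ∫ y, (B x).indicator φ y ∂μ := by
        refine Finset.sum_le_sum fun x hx => ?_
        rw [integral_indicator measurableSet_ball]
        refine setIntegral_ge_of_const_le_real measurableSet_ball measure_ball_lt_top.ne
          (fun y hy => hφ x y ?_) hint.integrableOn
        exact (norm_le_and_dist_lt_of_mem_shifted_ball hr (hs x hx) hy).1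
    _ = ∫ y, ∑ x ∈ s, (B x).indicator φ y ∂μ :=
        (integral_finsetSum _ fun x _ => hind x).symm
    _ ≤ ∫ y, M * φ y ∂μ := by
        refine integral_mono (integrable_finsetSum _ fun x _ => hind x) (hint.const_mul _)
          fun y => ?_
        calc ∑ x ∈ s, (B x).indicator φ y
            ≤ ∑ x ∈ s, if dist x y < r then φ y else 0 := by
              refine Finset.sum_le_sum fun x hx => ?_
              by_cases hy : y ∈ B x
              · rw [indicator_of_mem hy,
                  if_pos (norm_le_and_dist_lt_of_mem_shifted_ball hr (hs x hx) hy).2]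
              · rw [indicator_of_notMem hy]
                split_ifs
                exacts [hφ0 y, le_rfl]
          _ = (s.filter fun x => dist x y < r).card * φ y := by
              rw [← Finset.sum_filter, Finset.sum_const, nsmul_eq_mul]
          _ ≤ M * φ y := by
              gcongr
              exacts [hφ0 y, hM y]
    _ = M * ∫ x, φ x ∂μ := integral_const_mul _ _

/-- The sum of a radially non-increasing probability density over a finite set, no point of the
space being within `r` of more than `M` of its elements. -/
lemma sum_le_of_overlap {φ : E → ℝ} (hφ0 : ∀ x, 0 ≤ φ x)
    (hφ : ∀ x y, ‖y‖ ≤ ‖x‖ → φ x ≤ φ y) (hφ1 : ∫ x, φ x ∂μ = 1)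
    {r : ℝ} (hr : 0 < r) {M : ℕ} {s : Finset E}
    (hM : ∀ z, (s.filter fun x => dist x z < r).card ≤ M) :
    ∑ x ∈ s, φ x ≤ M * (φ 0 + (2 / r) ^ Module.finrank ℝ E * (μ.real (ball 0 1))⁻¹) := by
  have hint : Integrable φ μ := by
    by_contra h
    simp [integral_undef h] at hφ1
  have hball : 0 < μ.real (ball (0 : E) 1) :=
    ENNReal.toReal_pos (measure_ball_pos μ 0 one_pos).ne' measure_ball_lt_top.ne
  rw [← Finset.sum_filter_add_sum_filter_not s (fun x => ‖x‖ < r), mul_add]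
  refine add_le_add ?_ ?_
  · calc ∑ x ∈ s with ‖x‖ < r, φ x
        ≤ (s.filter fun x => ‖x‖ < r).card • φ 0 :=
          Finset.sum_le_card_nsmul _ _ _ fun x _ => hφ x 0 (by simp)
      _ ≤ M * φ 0 := by
          rw [nsmul_eq_mul]
          gcongr
          · exact hφ0 0
          · simpa using hM 0
  · have key := sum_mul_measureReal_ball_le_of_overlap μ hφ0 hφ hint hr
      (s := s.filter fun x => ¬ ‖x‖ < r) (M := M) (by simp) fun z =>
        (Finset.card_le_card (Finset.filter_subset_filter _ (Finset.filter_subset _ _))).trans (hM z)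
    rw [hφ1, mul_one, ← le_div_iff₀ (by positivity)] at key
    refine key.trans_eq ?_
    rw [div_pow, div_pow]
    field_simp

end BoundedOverlap

/-- Lemma 4.3: if `φ(x) = ψ(|x|)` is a (spherically symmetric, radially non-increasing)
probability density on `ℝ^d`, `lam > 0` and `𝒳 ⊆ ℝ^d` admits a partition into `M` parts each of
which is `2*lam`-separated, then `∑_{x ∈ 𝒳} φ x ≤ M * (‖φ‖_∞ + (3/lam)^d * ω_d⁻¹)`, where
`ω_d` is the volume of the unit ball. The same bound holds whenever every `x₀ ∈ 𝒳` has at most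
`M` points of `𝒳` within distance `2*lam`. -/
theorem sum_density_at_well_spaced_points
    {d : ℕ}
    (φ : EuclideanSpace ℝ (Fin d) → ℝ) (ψ : ℝ → ℝ)
    (hφψ : ∀ x, φ x = ψ ‖x‖)
    (hψmono : AntitoneOn ψ (Set.Ici (0 : ℝ))) (hψ0 : ∀ r, 0 ≤ ψ r)
    (hφmeas : Measurable φ) (hφ1 : ∫ x, φ x = 1)
    (lam : ℝ) (hlam : 0 < lam) (M : ℕ) (hM : 1 ≤ M)
    (𝒳 : Set (EuclideanSpace ℝ (Fin d))) (h𝒳 : 𝒳.Countable) :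
    ((∃ P : Fin M → Set (EuclideanSpace ℝ (Fin d)),
        (⋃ m, P m) = 𝒳 ∧
        (Pairwise fun m m' => Disjoint (P m) (P m')) ∧
        (∀ m, ∀ x ∈ P m, ∀ y ∈ P m, x ≠ y → 2 * lam ≤ dist x y)) →
      ∑' x : 𝒳, φ x
        ≤ (M : ℝ) * ((⨆ x, φ x)
            + (3 / lam) ^ d
              * ((volume (closedBall (0 : EuclideanSpace ℝ (Fin d)) 1)).toReal)⁻¹)) ∧
    ((∀ x₀ ∈ 𝒳, ({x ∈ 𝒳 | dist x x₀ < 2 * lam}).Finite ∧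
        ({x ∈ 𝒳 | dist x x₀ < 2 * lam}).ncard ≤ M) →
      ∑' x : 𝒳, φ x
        ≤ (M : ℝ) * ((⨆ x, φ x)
            + (3 / lam) ^ d
              * ((volume (closedBall (0 : EuclideanSpace ℝ (Fin d)) 1)).toReal)⁻¹)) := by
  have hφ0 (x) : 0 ≤ φ x := hφψ x ▸ hψ0 _
  have hφ (x y : EuclideanSpace ℝ (Fin d)) (hxy : ‖y‖ ≤ ‖x‖) : φ x ≤ φ y := by
    rw [hφψ, hφψ]
    exact hψmono (norm_nonneg y) (norm_nonneg x) hxy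
  have hsup : φ 0 ≤ ⨆ x, φ x :=
    le_ciSup ⟨φ 0, by rintro _ ⟨x, rfl⟩; exact hφ x 0 (by simp)⟩ 0
  have bound (hoverlap : ∀ s : Finset (EuclideanSpace ℝ (Fin d)), ↑s ⊆ 𝒳 →
      ∀ z, (s.filter fun x => dist x z < lam).card ≤ M) :
      ∑' x : 𝒳, φ x
        ≤ (M : ℝ) * ((⨆ x, φ x)
            + (3 / lam) ^ d
              * ((volume (closedBall (0 : EuclideanSpace ℝ (Fin d)) 1)).toReal)⁻¹) := by
    have hsup0 := (hφ0 0).trans hsup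
    refine tsum_le_of_sum_le' (by positivity) fun s => ?_
    have h := sum_le_of_overlap volume hφ0 hφ hφ1 hlam
      (hoverlap (s.map (Function.Embedding.subtype _)) (by simp))
    rw [Finset.sum_map, finrank_euclideanSpace_fin, measureReal_def,
      ← Measure.addHaar_unitClosedBall_eq_addHaar_unitBall] at h
    refine h.trans ?_
    gcongr
    norm_num
  refine ⟨?_, fun hnear => bound fun s hs z => ?_⟩
  · rintro ⟨P, rfl, -, hsep⟩
    refine bound fun s hs z => ?_
    have : NeZero M := ⟨by lia⟩
    choose! c hc using fun x (hx : x ∈ s) => mem_iUnion.1 (hs hx)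
    refine (Finset.card_le_card_of_injOn c (fun _ _ => Finset.mem_univ _) ?_).trans_eq
      (Finset.card_fin M)
    intro x hx y hy hxy
    simp only [Finset.coe_filter, mem_ofPred_eq] at hx hy
    by_contra hne
    have := hsep (c x) x (hc x hx.1) y (hxy ▸ hc y hy.1) hne
    linarith [dist_triangle_right x y z]
  · obtain h | ⟨x₀, hx₀⟩ := (s.filter fun x => dist x z < lam).eq_empty_or_nonempty
    · simp [h]
    · rw [Finset.mem_filter] at hx₀
      obtain ⟨hfin, hcard⟩ := hnear x₀ (hs hx₀.1)
      rw [← Set.ncard_coe_finset]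
      refine (Set.ncard_le_ncard (fun x hx => ?_) hfin).trans hcard
      simp only [Finset.coe_filter, mem_ofPred_eq] at hx
      exact ⟨hs hx.1, by linarith [dist_triangle_right x x₀ z]⟩
end

section
/- Let {T_i} be a family of √τ-bi-Lipschitz maps on ℝ^d, set T_{ij} = T_i^{−1} ∘ T_j, and suppose that for some λ > 0 and M ≥ 1 and every i, j, the set {l : |T_{lj}(0) − T_{ij}(0)| < 2λ} has at most M elements. Then for every ε > 0, every w ∈ ℝ^d, and every i, j: #{ l : |T_{ij}(w) − T_{lj}(w)| < ε } ≤ M ( (λ + ε + 2τ|w|)/λ )^d. In particular, #{ l : |T_{ij}(0) − T_{lj}(0)| < ε } ≤ M ( (ε + λ)/λ )^d. -/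
open Metric Set

open MeasureTheory in
/-- Points in a ball of radius `R`, at most `M` of which lie within `2 * r` of any given one,
number at most `M * ((r + R) / r) ^ dim E`. -/
lemma card_le_mul_pow_of_ncard_near_le
    {E ι : Type*} [NormedAddCommGroup E] [NormedSpace ℝ E] [FiniteDimensional ℝ E]
    (p : ι → E) {r R : ℝ} (hr : 0 < r) (hR : 0 < R) (M : ℕ)
    (hM : ∀ i, {l | dist (p l) (p i) < 2 * r}.Finite ∧
      {l | dist (p l) (p i) < 2 * r}.ncard ≤ M)
    (c : E) (S : Finset ι) (hS : ∀ l ∈ S, dist (p l) c < R) :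
    (S.card : ℝ) ≤ M * ((r + R) / r) ^ Module.finrank ℝ E := by
  classical
  borelize E
  let μ : Measure E := Measure.addHaar
  have hoverlap : ∀ x, ∑ l ∈ S, (ball (p l) r).indicator (1 : E → ENNReal) x
      ≤ (ball c (r + R)).indicator (fun _ => (M : ENNReal)) x := by
    intro x
    have hsum : ∑ l ∈ S, (ball (p l) r).indicator (1 : E → ENNReal) x
        = ((S.filter fun l => x ∈ ball (p l) r).card : ENNReal) := by
      simp [Set.indicator_apply]
    rw [hsum]
    rcases (S.filter fun l => x ∈ ball (p l) r).eq_empty_or_nonempty with h | ⟨i, hi⟩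
    · rw [h]
      simp
    · rw [Finset.mem_filter, mem_ball] at hi
      have hx : x ∈ ball c (r + R) := by
        rw [mem_ball]
        linarith [dist_triangle x (p i) c, hS i hi.1]
      rw [Set.indicator_of_mem hx]
      have hsub : ((S.filter fun l => x ∈ ball (p l) r : Finset ι) : Set ι)
          ⊆ {l | dist (p l) (p i) < 2 * r} := by
        intro l hl
        have hl' := (Finset.mem_filter.mp (Finset.mem_coe.mp hl)).2
        rw [mem_ball] at hl'
        rw [Set.mem_ofPred_eq]
        linarith [dist_triangle_left (p l) (p i) x]
      have hcard := Set.ncard_le_ncard hsub (hM i).1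
      rw [Set.ncard_coe_finset] at hcard
      exact_mod_cast hcard.trans (hM i).2
  have hint := lintegral_mono (μ := μ) hoverlap
  rw [lintegral_finsetSum _ fun l _ => measurable_one.indicator measurableSet_ball,
    lintegral_indicator_const measurableSet_ball] at hint
  simp only [lintegral_indicator_one measurableSet_ball] at hint
  have hball : ∀ x, ∀ s : ℝ, 0 < s →
      μ.real (ball x s) = s ^ Module.finrank ℝ E * μ.real (ball 0 1) := by
    intro x s hs
    rw [measureReal_def, Measure.addHaar_ball_of_pos μ x hs, ENNReal.toReal_mul,
      ENNReal.toReal_ofReal (by positivity), measureReal_def]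
  have hreal := ENNReal.toReal_mono
    (ENNReal.mul_ne_top (ENNReal.natCast_ne_top M) measure_ball_lt_top.ne) hint
  rw [ENNReal.toReal_sum fun l _ => measure_ball_lt_top.ne, ENNReal.toReal_mul,
    ENNReal.toReal_natCast] at hreal
  simp only [← measureReal_def, hball _ _ hr, hball _ _ (add_pos hr hR), Finset.sum_const,
    nsmul_eq_mul] at hreal
  have hunit : 0 < μ.real (ball (0 : E) 1) :=
    ENNReal.toReal_pos (measure_ball_pos μ 0 one_pos).ne' measure_ball_lt_top.ne
  rw [div_pow, ← mul_div_assoc, le_div_iff₀ (by positivity)]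
  rw [← mul_assoc, ← mul_assoc] at hreal
  exact le_of_mul_le_mul_right hreal hunit

/-- A set all of whose finite subsets have at most `B` elements is finite with at most `B`
elements. -/
lemma finite_and_ncard_le_of_forall_finset_card_le {ι : Type*} {s : Set ι} {B : ℝ}
    (h : ∀ S : Finset ι, (S : Set ι) ⊆ s → (S.card : ℝ) ≤ B) :
    s.Finite ∧ (s.ncard : ℝ) ≤ B := by
  have hfin : s.Finite := by
    by_contra hs
    obtain ⟨n, hn⟩ := exists_nat_gt B
    obtain ⟨S, hS, hcard⟩ := Set.Infinite.exists_subset_card_eq hs n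
    have := h S hS
    rw [hcard] at this
    exact absurd this hn.not_ge
  refine ⟨hfin, ?_⟩
  rw [Set.ncard_eq_toFinset_card s hfin]
  exact h _ (by simp)

/-- If `f` and `g` are `√τ`-bi-Lipschitz bijections, then `f⁻¹ ∘ g` is `τ`-Lipschitz. -/
lemma dist_invFun_comp_le {X : Type*} [MetricSpace X] [Nonempty X] {τ : ℝ} (hτ : 0 < τ)
    {f g : X → X} (hf : Function.Surjective f)
    (hflip : ∀ x y, (1 / Real.sqrt τ) * dist x y ≤ dist (f x) (f y))
    (hglip : ∀ x y, dist (g x) (g y) ≤ Real.sqrt τ * dist x y) (x y : X) :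
    dist ((Function.invFun f ∘ g) x) ((Function.invFun f ∘ g) y) ≤ τ * dist x y := by
  have hs : 0 < Real.sqrt τ := Real.sqrt_pos.mpr hτ
  have h := hflip (Function.invFun f (g x)) (Function.invFun f (g y))
  rw [Function.rightInverse_invFun hf, Function.rightInverse_invFun hf, one_div,
    inv_mul_le_iff₀ hs] at h
  calc dist ((Function.invFun f ∘ g) x) ((Function.invFun f ∘ g) y)
      ≤ Real.sqrt τ * dist (g x) (g y) := h
    _ ≤ Real.sqrt τ * (Real.sqrt τ * dist x y) := by gcongr; exact hglip x y
    _ = τ * dist x y := by rw [← mul_assoc, Real.mul_self_sqrt hτ.le]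

/-- Lemma 4.4 (counting points in balls): let `{T i}` be `√τ`-bi-Lipschitz bijections of `ℝ^d`
and `T_{ij} = T i⁻¹ ∘ T j`. If for all `i, j` at most `M` indices `l` satisfy
`|T_{lj} 0 - T_{ij} 0| < 2*lam`, then for every `ε > 0`, `w`, `i`, `j`:
`#{l : |T_{ij} w - T_{lj} w| < ε} ≤ M * ((lam + ε + 2*τ*|w|)/lam)^d`; in particular
`#{l : |T_{ij} 0 - T_{lj} 0| < ε} ≤ M * ((ε + lam)/lam)^d`. -/
theorem counting_points_in_balls
    {d : ℕ} {ι : Type*}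
    (τ lam : ℝ) (hτ : 0 < τ) (hlam : 0 < lam) (M : ℕ)
    (T : ι → EuclideanSpace ℝ (Fin d) → EuclideanSpace ℝ (Fin d))
    (hbij : ∀ i, Function.Bijective (T i))
    (hlip : ∀ i x y, (1 / Real.sqrt τ) * dist x y ≤ dist (T i x) (T i y) ∧
                      dist (T i x) (T i y) ≤ Real.sqrt τ * dist x y)
    (Tij : ι → ι → EuclideanSpace ℝ (Fin d) → EuclideanSpace ℝ (Fin d))
    (hTij : ∀ i j, Tij i j = Function.invFun (T i) ∘ T j)
    (hM : ∀ i j, {l | dist (Tij l j 0) (Tij i j 0) < 2 * lam}.Finite ∧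
                 {l | dist (Tij l j 0) (Tij i j 0) < 2 * lam}.ncard ≤ M) :
    (∀ ε : ℝ, 0 < ε → ∀ (w : EuclideanSpace ℝ (Fin d)) (i j : ι),
      {l | dist (Tij i j w) (Tij l j w) < ε}.Finite ∧
      (({l | dist (Tij i j w) (Tij l j w) < ε}.ncard : ℝ)
        ≤ (M : ℝ) * ((lam + ε + 2 * τ * ‖w‖) / lam) ^ d)) ∧
    (∀ ε : ℝ, 0 < ε → ∀ i j : ι,
      {l | dist (Tij i j 0) (Tij l j 0) < ε}.Finite ∧
      (({l | dist (Tij i j 0) (Tij l j 0) < ε}.ncard : ℝ)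
        ≤ (M : ℝ) * ((ε + lam) / lam) ^ d)) := by
  have key : ∀ ε : ℝ, 0 < ε → ∀ (w : EuclideanSpace ℝ (Fin d)) (i j : ι),
      {l | dist (Tij i j w) (Tij l j w) < ε}.Finite ∧
      (({l | dist (Tij i j w) (Tij l j w) < ε}.ncard : ℝ)
        ≤ (M : ℝ) * ((lam + ε + 2 * τ * ‖w‖) / lam) ^ d) := by
    intro ε hε w i j
    refine finite_and_ncard_le_of_forall_finset_card_le fun S hS => ?_
    have hw : ∀ l, dist (Tij l j w) (Tij l j 0) ≤ τ * ‖w‖ := by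
      intro l
      rw [hTij, ← dist_zero_right w]
      exact dist_invFun_comp_le hτ (hbij l).2 (fun x y => (hlip l x y).1)
        (fun x y => (hlip j x y).2) w 0
    have hcard := card_le_mul_pow_of_ncard_near_le (fun l => Tij l j 0) hlam
      (R := ε + 2 * τ * ‖w‖) (by positivity) M (fun k => hM k j) (Tij i j 0) S (by
        intro l hl
        have hlw : dist (Tij i j w) (Tij l j w) < ε := hS hl
        have h1 := dist_triangle4 (Tij l j 0) (Tij l j w) (Tij i j w) (Tij i j 0)
        rw [dist_comm (Tij l j 0) (Tij l j w), dist_comm (Tij l j w) (Tij i j w)] at h1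
        linarith [hw l, hw i])
    rwa [finrank_euclideanSpace_fin, ← add_assoc] at hcard
  refine ⟨key, fun ε hε i j => ?_⟩
  simpa [add_comm] using key ε hε 0 i j
end

section
/- Let X be a random variable on a countable index set 𝒳 with ℙ(X = x) = p_x, and let Z be an ℝ^d-valued random variable such that for each x, the conditional law of Z given X = x is that of T_x(W), where W has a spherically symmetric log-concave density φ on ℝ^d and each T_x is a √τ-bi-Lipschitz map (τ ≥ 1). Set T_{ij} = T_i^{−1} ∘ T_j and suppose there exists λ > 0 such that T_{ij}(B_λ) ∩ T_{kj}(B_λ) = ∅ whenever k ≠ i. Then h(Z) − h(Z|X) ≥ H(X) − C̃(W), where, writing 𝒯(t) = ℙ(|W| > t), C̃(W) = 𝒯(λ)(1 + h(W)) + 𝒯(λ)^{1/2}(√d + K(φ)) and K(φ) = log[ τ^d ( ‖φ‖_∞ + (3/λ)^d ω_d^{−1} ) ] · ℙ(|W| > λ)^{1/2} + d ( ∫_{|w| > λ} φ(w) log²( 1 + τ + τ²|w|/λ ) dw )^{1/2}, with ω_d the Lebesgue volume of the d-dimensional unit ball. -/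
open MeasureTheory Metric Set Real

/-- A symmetrized, Chebyshev-type comparison of products of integrals. -/
theorem lintegral_mul_lintegral_le_of_symm {α : Type*} [MeasurableSpace α]
    {μ : Measure α} {a b c e : α → ENNReal} (ha : Measurable a) (hb : Measurable b)
    (hc : Measurable c) (he : Measurable e)
    (h : ∀ x y, a x * b y + a y * b x ≤ c x * e y + c y * e x) :
    (∫⁻ x, a x ∂μ) * ∫⁻ x, b x ∂μ ≤ (∫⁻ x, c x ∂μ) * ∫⁻ x, e x ∂μ := by
  have key : ∀ a b : α → ENNReal, Measurable a → Measurable b →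
      ∫⁻ x, ∫⁻ y, (a x * b y + a y * b x) ∂μ ∂μ = 2 * ((∫⁻ x, a x ∂μ) * ∫⁻ x, b x ∂μ) := by
    intro a b ha hb
    have : ∀ x, ∫⁻ y, (a x * b y + a y * b x) ∂μ =
        a x * (∫⁻ y, b y ∂μ) + (∫⁻ y, a y ∂μ) * b x := by
      intro x
      rw [lintegral_add_left (hb.const_mul _), lintegral_const_mul _ hb, lintegral_mul_const _ ha]
    simp_rw [this]
    rw [lintegral_add_left (ha.mul_const _), lintegral_const_mul _ hb, lintegral_mul_const _ ha,
      two_mul]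
  have h2 : ∫⁻ x, ∫⁻ y, (a x * b y + a y * b x) ∂μ ∂μ ≤
      ∫⁻ x, ∫⁻ y, (c x * e y + c y * e x) ∂μ ∂μ :=
    lintegral_mono fun x => lintegral_mono fun y => h x y
  rw [key a b ha hb, key c e hc he] at h2
  exact (ENNReal.mul_le_mul_iff_right (by norm_num) (by norm_num)).1 h2

theorem lintegral_comp_const_smul {E : Type*} [NormedAddCommGroup E] [NormedSpace ℝ E]
    [FiniteDimensional ℝ E] [MeasurableSpace E] [BorelSpace E] (μ : Measure E)
    [μ.IsAddHaarMeasure] {s : ℝ} (hs : 0 < s) {g : E → ENNReal} (hg : Measurable g) :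
    ∫⁻ x, g (s • x) ∂μ = ENNReal.ofReal ((s ^ Module.finrank ℝ E)⁻¹) * ∫⁻ x, g x ∂μ := by
  rw [← lintegral_map hg (measurable_const_smul s), Measure.map_addHaar_smul μ hs.ne',
    lintegral_smul_measure, abs_of_pos (by positivity), smul_eq_mul]

/-- A nonnegative, radially symmetric, log-concave function on a real normed space. -/
structure RadialLogConcave {E : Type*} [NormedAddCommGroup E] [NormedSpace ℝ E]
    (φ : E → ℝ) : Prop where
  nonneg : ∀ x, 0 ≤ φ x
  radial : ∀ x y, ‖x‖ = ‖y‖ → φ x = φ y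
  logConcave : ∀ x y : E, ∀ s ∈ Set.Icc (0 : ℝ) 1,
    φ x ^ (1 - s) * φ y ^ s ≤ φ ((1 - s) • x + s • y)

namespace RadialLogConcave

variable {E : Type*} [NormedAddCommGroup E] [NormedSpace ℝ E] {φ : E → ℝ}

theorem antitone (h : RadialLogConcave φ) {x y : E} (hxy : ‖x‖ ≤ ‖y‖) : φ y ≤ φ x := by
  rcases (norm_nonneg y).eq_or_lt with hy | hy
  · rw [h.radial x y (le_antisymm hxy (hy ▸ norm_nonneg x))]
  have ht0 : 0 ≤ ‖x‖ / ‖y‖ := by positivity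
  have ht1 : ‖x‖ / ‖y‖ ≤ 1 := (div_le_one hy).2 hxy
  set t := ‖x‖ / ‖y‖ with ht
  have hlc := h.logConcave (-y) y ((1 + t) / 2) ⟨by linarith, by linarith⟩
  have e : (1 - (1 + t) / 2) • (-y) + ((1 + t) / 2) • y = t • y := by module
  rw [e, h.radial (-y) y (norm_neg y), h.radial (t • y) x ?_] at hlc
  · rcases (h.nonneg y).eq_or_lt with h0 | h0
    · rw [← h0]; exact h.nonneg x
    · rwa [← Real.rpow_add h0, sub_add_cancel, Real.rpow_one] at hlc
  · rw [norm_smul, Real.norm_of_nonneg ht0, ht, div_mul_cancel₀ _ hy.ne']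

theorem scaled_mul_rpow_le (h : RadialLogConcave φ) {s : ℝ} (hs0 : 0 < s) (hs1 : s < 1)
    {x y : E} (hxy : ‖x‖ ≤ ‖y‖) : φ (s • x) * φ y ^ s ≤ φ (s • y) * φ x ^ s := by
  rcases (h.nonneg y).eq_or_lt with h0 | hφy
  · rw [← h0, Real.zero_rpow hs0.ne', mul_zero]
    exact mul_nonneg (h.nonneg _) (Real.rpow_nonneg (h.nonneg _) _)
  rcases (norm_nonneg y).eq_or_lt with hy | hy
  · have hx : ‖x‖ = ‖y‖ := le_antisymm hxy (hy ▸ norm_nonneg x)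
    rw [h.radial x y hx, h.radial (s • x) (s • y) (by rw [norm_smul, norm_smul, hx])]
  have ht0 : 0 ≤ ‖x‖ / ‖y‖ := by positivity
  have ht1 : ‖x‖ / ‖y‖ ≤ 1 := (div_le_one hy).2 hxy
  set t := ‖x‖ / ‖y‖ with ht
  have hxt : ‖t • y‖ = ‖x‖ := by
    rw [norm_smul, Real.norm_of_nonneg ht0, ht, div_mul_cancel₀ _ hy.ne']
  have hst : 0 < 1 - s * t := by nlinarith
  have hz : φ (s • x) = φ (s • t • y) := h.radial _ _ (by rw [norm_smul, norm_smul, hxt])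
  have hzpos : 0 < φ (s • t • y) := hφy.trans_le (h.antitone (by
    rw [norm_smul, norm_smul, Real.norm_of_nonneg ht0, Real.norm_of_nonneg hs0.le]
    nlinarith [mul_nonneg (mul_nonneg hs0.le ht0) hy.le]))
  rw [h.radial x (t • y) hxt.symm, hz]
  set a := s * (1 - t) / (1 - s * t) with ha
  set b := t * (1 - s) / (1 - s * t) with hb
  have ha' : a ∈ Set.Icc (0 : ℝ) 1 := by
    constructor
    · rw [ha]; exact div_nonneg (mul_nonneg hs0.le (by linarith)) hst.le
    · rw [ha, div_le_one hst]; linarith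
  have hb' : b ∈ Set.Icc (0 : ℝ) 1 := by
    constructor
    · rw [hb]; exact div_nonneg (mul_nonneg ht0 (by linarith)) hst.le
    · rw [hb, div_le_one hst]; linarith
  have h1 := h.logConcave (s • t • y) y a ha'
  have h2 := h.logConcave (s • t • y) y b hb'
  have e1 : (1 - a) • s • t • y + a • y = s • y := by
    have : (1 - a) * (s * t) + a = s := by
      linear_combination (div_mul_cancel₀ (s * (1 - t)) hst.ne')
    rw [smul_smul, smul_smul, ← add_smul, mul_assoc, this]
  have e2 : (1 - b) • s • t • y + b • y = t • y := by
    have : (1 - b) * (s * t) + b = t := by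
      linear_combination (div_mul_cancel₀ (t * (1 - s)) hst.ne')
    rw [smul_smul, smul_smul, ← add_smul, mul_assoc, this]
  have hab : a + b * s = s := by rw [ha, hb]; field_simp; ring
  rw [e1] at h1
  rw [e2] at h2
  have h3 := Real.rpow_le_rpow (by positivity) h2 hs0.le
  rw [Real.mul_rpow (by positivity) (by positivity), ← Real.rpow_mul hzpos.le,
    ← Real.rpow_mul hφy.le] at h3
  calc φ (s • t • y) * φ y ^ s
      = φ (s • t • y) ^ ((1 - a) + (1 - b) * s) * φ y ^ (a + b * s) := by
        rw [hab, show (1 - a) + (1 - b) * s = 1 by linarith, Real.rpow_one]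
    _ = (φ (s • t • y) ^ (1 - a) * φ y ^ a) * (φ (s • t • y) ^ ((1 - b) * s) * φ y ^ (b * s)) := by
        rw [Real.rpow_add hzpos, Real.rpow_add hφy]; ring
    _ ≤ _ := mul_le_mul h1 h3 (by positivity) (h.nonneg _)

theorem association (h : RadialLogConcave φ) {s : ℝ} (hs0 : 0 < s) (hs1 : s < 1) (x y : E) :
    φ (s • x) * φ (s • x) ^ (1 - s) * φ y ^ s + φ (s • y) * φ (s • y) ^ (1 - s) * φ x ^ s ≤
      φ (s • x) * (φ y ^ s * φ (s • y) ^ (1 - s)) +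
        φ (s • y) * (φ x ^ s * φ (s • x) ^ (1 - s)) := by
  wlog hxy : ‖x‖ ≤ ‖y‖ generalizing x y
  · have := this y x (le_of_not_ge hxy)
    linarith
  have h1 := h.scaled_mul_rpow_le hs0 hs1 hxy
  have h2 : φ (s • y) ^ (1 - s) ≤ φ (s • x) ^ (1 - s) :=
    Real.rpow_le_rpow (h.nonneg _) (h.antitone (by
      rw [norm_smul, norm_smul]; gcongr)) (by linarith)
  nlinarith [mul_nonneg (sub_nonneg.2 h1) (sub_nonneg.2 h2)]

theorem lintegral_rpow_mul_lintegral_rpow_le [FiniteDimensional ℝ E] [MeasurableSpace E]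
    [BorelSpace E] (μ : Measure E) [μ.IsAddHaarMeasure] (h : RadialLogConcave φ)
    (hm : Measurable φ) (h1 : ∫⁻ x, ENNReal.ofReal (φ x) ∂μ = 1)
    {s : ℝ} (hs0 : 0 < s) (hs1 : s < 1) :
    (∫⁻ x, ENNReal.ofReal (φ x * φ x ^ (1 - s)) ∂μ) * (∫⁻ x, ENNReal.ofReal (φ x ^ s) ∂μ) ≤
      ENNReal.ofReal ((s ^ Module.finrank ℝ E)⁻¹ ^ (1 - s)) := by
  have hsm : Measurable fun x : E => s • x := measurable_const_smul s
  have hms : Measurable fun x => φ (s • x) := hm.comp hsm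
  have key := lintegral_mul_lintegral_le_of_symm (μ := μ)
    (a := fun x => ENNReal.ofReal (φ (s • x) * φ (s • x) ^ (1 - s)))
    (b := fun x => ENNReal.ofReal (φ x ^ s))
    (c := fun x => ENNReal.ofReal (φ (s • x)))
    (e := fun x => ENNReal.ofReal (φ x ^ s * φ (s • x) ^ (1 - s)))
    (by fun_prop) (by fun_prop) (by fun_prop) (by fun_prop) (by
      intro x y
      have n1 := h.nonneg (s • x)
      have n2 := h.nonneg (s • y)
      have n3 := h.nonneg x
      have n4 := h.nonneg y
      rw [← ENNReal.ofReal_mul (by positivity), ← ENNReal.ofReal_mul (by positivity),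
        ← ENNReal.ofReal_mul (by positivity), ← ENNReal.ofReal_mul (by positivity),
        ← ENNReal.ofReal_add (by positivity) (by positivity),
        ← ENNReal.ofReal_add (by positivity) (by positivity)]
      exact ENNReal.ofReal_le_ofReal (h.association hs0 hs1 x y))
  rw [lintegral_comp_const_smul μ hs0 (g := fun x => ENNReal.ofReal (φ x * φ x ^ (1 - s)))
    (by fun_prop), lintegral_comp_const_smul μ hs0 (g := fun x => ENNReal.ofReal (φ x))
    (by fun_prop), h1, mul_one, mul_assoc] at key
  refine ((ENNReal.mul_le_mul_iff_right (ENNReal.ofReal_pos.2 (by positivity)).ne'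
    ENNReal.ofReal_ne_top).1 key).trans ?_
  have hold := ENNReal.lintegral_mul_norm_pow_le (μ := μ) (f := fun x => ENNReal.ofReal (φ x))
    (g := fun x => ENNReal.ofReal (φ (s • x))) (by fun_prop) (by fun_prop) hs0.le
    (sub_nonneg.2 hs1.le) (by ring)
  rw [lintegral_comp_const_smul μ hs0 (g := fun x => ENNReal.ofReal (φ x))
    (by fun_prop), h1, ENNReal.one_rpow, one_mul, mul_one,
    ENNReal.ofReal_rpow_of_nonneg (by positivity) (by linarith)] at hold
  refine le_trans (le_of_eq (lintegral_congr fun x => ?_)) hold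
  rw [ENNReal.ofReal_mul (Real.rpow_nonneg (h.nonneg _) _),
    ENNReal.ofReal_rpow_of_nonneg (h.nonneg _) hs0.le,
    ENNReal.ofReal_rpow_of_nonneg (h.nonneg _) (by linarith)]

end RadialLogConcave

theorem Real.one_add_sq_div_two_le_cosh (x : ℝ) : 1 + x ^ 2 / 2 ≤ Real.cosh x := by
  have h1 := Real.cosh_two_mul (x / 2)
  rw [show 2 * (x / 2) = x by ring, Real.cosh_sq] at h1
  have h2 : (x / 2) ^ 2 ≤ Real.sinh (x / 2) ^ 2 := by
    rw [sq_le_sq, Real.abs_sinh]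
    exact Real.self_le_sinh_iff.2 (abs_nonneg _)
  nlinarith

theorem lintegral_sq_sub_le_of_exp_moments {Ω : Type*} [MeasurableSpace Ω] {P : Measure Ω}
    [IsProbabilityMeasure P] {X : Ω → ℝ} (hX : Measurable X) {C : ℝ}
    (h : ∀ ε ∈ Ioo (0 : ℝ) 1,
      (∫⁻ x, ENNReal.ofReal (exp (ε * X x)) ∂P) * (∫⁻ x, ENNReal.ofReal (exp (-(ε * X x))) ∂P) ≤
        ENNReal.ofReal (exp (C * ε ^ 2 / (1 - ε)))) :
    ∫⁻ z, ENNReal.ofReal ((X z.1 - X z.2) ^ 2) ∂(P.prod P) ≤ ENNReal.ofReal (2 * C) := by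
  set m := ∫⁻ z, ENNReal.ofReal ((X z.1 - X z.2) ^ 2) ∂(P.prod P) with hm
  have step : ∀ ε ∈ Ioo (0 : ℝ) 1,
      1 + ENNReal.ofReal (ε ^ 2 / 2) * m ≤ ENNReal.ofReal (exp (C * ε ^ 2 / (1 - ε))) := by
    intro ε hε
    refine le_trans ?_ (h ε hε)
    have e1 := lintegral_prod_mul (μ := P) (ν := P)
      (f := fun x => ENNReal.ofReal (exp (ε * X x)))
      (g := fun x => ENNReal.ofReal (exp (-(ε * X x)))) (by fun_prop) (by fun_prop)
    have e2 := lintegral_prod_mul (μ := P) (ν := P)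
      (f := fun x => ENNReal.ofReal (exp (-(ε * X x))))
      (g := fun x => ENNReal.ofReal (exp (ε * X x))) (by fun_prop) (by fun_prop)
    rw [mul_comm (∫⁻ x, ENNReal.ofReal (exp (-(ε * X x))) ∂P)] at e2
    refine (ENNReal.mul_le_mul_iff_right (a := 2) (by norm_num) (by norm_num)).1 ?_
    rw [two_mul ((∫⁻ x, ENNReal.ofReal (exp (ε * X x)) ∂P) * _)]
    nth_rewrite 1 [← e1]
    rw [← e2, ← lintegral_add_left (by fun_prop)]
    have : 2 * (1 + ENNReal.ofReal (ε ^ 2 / 2) * m) =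
        ∫⁻ z, (2 * (1 + ENNReal.ofReal (ε ^ 2 / 2) * ENNReal.ofReal ((X z.1 - X z.2) ^ 2)))
          ∂(P.prod P) := by
      rw [lintegral_const_mul _ (by fun_prop), lintegral_add_left (by fun_prop),
        lintegral_const_mul _ (by fun_prop)]
      simp [hm]
    rw [this]
    refine lintegral_mono fun z => ?_
    have hc := Real.one_add_sq_div_two_le_cosh (ε * X z.1 - ε * X z.2)
    rw [Real.cosh_eq] at hc
    rw [← ENNReal.ofReal_mul (by positivity), ← ENNReal.ofReal_mul (by positivity),
      ← ENNReal.ofReal_mul (by positivity), ← Real.exp_add, ← Real.exp_add,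
      ← ENNReal.ofReal_add (by positivity) (by positivity), ← ENNReal.ofReal_one,
      ← ENNReal.ofReal_add (by positivity) (by positivity),
      ← ENNReal.ofReal_ofNat, ← ENNReal.ofReal_mul (by positivity)]
    refine ENNReal.ofReal_le_ofReal ?_
    rw [← sub_eq_add_neg, show -(ε * X z.1) + ε * X z.2 = -(ε * X z.1 - ε * X z.2) by ring]
    nlinarith
  have hfin : m ≠ ⊤ := by
    intro htop
    have := step (1 / 2) (by norm_num)
    rw [htop, ENNReal.mul_top (ENNReal.ofReal_pos.2 (by norm_num)).ne'] at this
    simp at this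
  rw [← ENNReal.ofReal_toReal hfin]
  refine ENNReal.ofReal_le_ofReal ?_
  have stepR : ∀ ε ∈ Ioo (0 : ℝ) 1, 1 + ε ^ 2 / 2 * m.toReal ≤ exp (C * ε ^ 2 / (1 - ε)) := by
    intro ε hε
    have := step ε hε
    rw [← ENNReal.ofReal_toReal hfin, ← ENNReal.ofReal_one,
      ← ENNReal.ofReal_mul (by positivity),
      ← ENNReal.ofReal_add (by positivity) (by positivity)] at this
    exact (ENNReal.ofReal_le_ofReal_iff (exp_pos _).le).1 this
  have hlim : Filter.Tendsto (fun ε : ℝ => 2 * (C / (1 - ε) / (1 - C * ε ^ 2 / (1 - ε))))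
      (nhdsWithin 0 (Ioi 0)) (nhds (2 * C)) := by
    have : ContinuousAt (fun ε : ℝ => 2 * (C / (1 - ε) / (1 - C * ε ^ 2 / (1 - ε)))) 0 := by
      fun_prop (disch := norm_num)
    have h2 := this.tendsto.mono_left (nhdsWithin_le_nhds (s := Ioi (0 : ℝ)))
    simpa using h2
  refine ge_of_tendsto hlim ?_
  have hcont : ContinuousAt (fun ε : ℝ => C * ε ^ 2 / (1 - ε)) 0 := by
    fun_prop (disch := norm_num)
  have hsmall : ∀ᶠ ε : ℝ in nhdsWithin 0 (Ioi 0), C * ε ^ 2 / (1 - ε) < 1 :=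
    (hcont.tendsto.mono_left nhdsWithin_le_nhds).eventually_lt_const (by norm_num)
  filter_upwards [Ioo_mem_nhdsGT (show (0 : ℝ) < 1 by norm_num), hsmall] with ε hε hx
  have h1 := stepR ε hε
  have hpos : 0 < 1 - C * ε ^ 2 / (1 - ε) := by linarith
  have h2 : exp (C * ε ^ 2 / (1 - ε)) ≤ 1 / (1 - C * ε ^ 2 / (1 - ε)) := by
    have := Real.add_one_le_exp (-(C * ε ^ 2 / (1 - ε)))
    rw [Real.exp_neg] at this
    rw [one_div]
    exact (le_inv_comm₀ (by positivity) hpos).2 (by linarith)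
  have h3 : (ε ^ 2 / 2) * m.toReal ≤
      (ε ^ 2 / 2) * (2 * (C / (1 - ε) / (1 - C * ε ^ 2 / (1 - ε)))) := by
    have e : (ε ^ 2 / 2) * (2 * (C / (1 - ε) / (1 - C * ε ^ 2 / (1 - ε)))) =
        1 / (1 - C * ε ^ 2 / (1 - ε)) - 1 := by
      have : 1 - ε ≠ 0 := by linarith [hε.2]
      rw [eq_sub_iff_add_eq, eq_div_iff hpos.ne', add_mul, mul_div_assoc',
        mul_div_assoc', div_mul_cancel₀ _ hpos.ne']
      field_simp
      ring
    linarith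
  exact le_of_mul_le_mul_left h3 (by have := hε.1; positivity)

theorem setIntegral_le_of_lintegral_sq_sub_le {Ω : Type*} [MeasurableSpace Ω] {P : Measure Ω}
    [IsProbabilityMeasure P] {X : Ω → ℝ} (hX : Measurable X) (hint : Integrable X P) {C : ℝ}
    (hC : 0 ≤ C)
    (h : ∫⁻ z, ENNReal.ofReal ((X z.1 - X z.2) ^ 2) ∂(P.prod P) ≤ ENNReal.ofReal (2 * C))
    {A : Set Ω} (hA : MeasurableSet A) :
    ∫ x in A, X x ∂P ≤ P.real A * (∫ x, X x ∂P) + √(P.real A) * √C := by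
  set t := P.real A with ht
  have ht0 : 0 ≤ t := measureReal_nonneg
  have hDint : Integrable (fun z : Ω × Ω => (X z.1 - X z.2) ^ 2) (P.prod P) := by
    refine ⟨by fun_prop, ?_⟩
    rw [hasFiniteIntegral_iff_ofReal (Filter.Eventually.of_forall fun z => sq_nonneg _)]
    exact h.trans_lt ENNReal.ofReal_lt_top
  have hD : ∫ z, (X z.1 - X z.2) ^ 2 ∂(P.prod P) ≤ 2 * C := by
    rw [integral_eq_lintegral_of_nonneg_ae (Filter.Eventually.of_forall fun z => sq_nonneg _)
      (by fun_prop)]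
    exact ENNReal.toReal_le_of_le_ofReal (by positivity) h
  set J : Ω → ℝ := A.indicator 1 with hJ
  have hJm : Measurable J := measurable_one.indicator hA
  have hJint : Integrable J P := (integrable_const 1).indicator hA
  have hJt : ∫ x, J x ∂P = t := by rw [hJ, integral_indicator_one hA]
  have hXJ : ∀ x, X x * J x = A.indicator X x := fun x => by
    by_cases hx : x ∈ A <;> simp [hJ, hx]
  have hJJ : ∀ x, J x * J x = J x := fun x => by
    by_cases hx : x ∈ A <;> simp [hJ, hx]
  have hXJint : Integrable (fun x => X x * J x) P := by
    simp_rw [hXJ]; exact hint.indicator hA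
  have hXJeq : ∫ x, X x * J x ∂P = ∫ x in A, X x ∂P := by
    simp_rw [hXJ]; exact integral_indicator hA
  have fst : ∀ {g : Ω → ℝ}, Integrable g P → Integrable (fun z : Ω × Ω => g z.1) (P.prod P) :=
    fun hg => hg.comp_fst P
  have snd : ∀ {g : Ω → ℝ}, Integrable g P → Integrable (fun z : Ω × Ω => g z.2) (P.prod P) :=
    fun hg => hg.comp_snd P
  have ifst : ∀ g : Ω → ℝ, ∫ z, g z.1 ∂(P.prod P) = ∫ x, g x ∂P := fun g => by
    simpa using integral_fun_fst (μ := P) (ν := P) g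
  have isnd : ∀ g : Ω → ℝ, ∫ z, g z.2 ∂(P.prod P) = ∫ x, g x ∂P := fun g => by
    simpa using integral_fun_snd (μ := P) (ν := P) g
  have key : ∀ {g k : Ω → ℝ}, Integrable g P → Integrable k P →
      Integrable (fun x => g x * k x) P →
      Integrable (fun z : Ω × Ω => (g z.1 - g z.2) * (k z.1 - k z.2)) (P.prod P) ∧
      ∫ z, (g z.1 - g z.2) * (k z.1 - k z.2) ∂(P.prod P) =
        2 * (∫ x, g x * k x ∂P) - 2 * ((∫ x, g x ∂P) * ∫ x, k x ∂P) := by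
    intro g k hg hk hgk
    have e : (fun z : Ω × Ω => (g z.1 - g z.2) * (k z.1 - k z.2)) =
        fun z => (g z.1 * k z.1 + g z.2 * k z.2) - (g z.1 * k z.2 + k z.1 * g z.2) := by
      funext z; ring
    have i1 := fst hgk
    have i2 := snd hgk
    have i3 := hg.mul_prod hk
    have i4 := hk.mul_prod hg
    rw [e]
    have i5 : Integrable (fun z : Ω × Ω => g z.1 * k z.1 + g z.2 * k z.2) (P.prod P) := i1.add i2
    have i6 : Integrable (fun z : Ω × Ω => g z.1 * k z.2 + k z.1 * g z.2) (P.prod P) := i3.add i4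
    refine ⟨i5.sub i6, ?_⟩
    rw [integral_sub i5 i6, integral_add i1 i2, integral_add i3 i4,
      ifst (fun x => g x * k x), isnd (fun x => g x * k x), integral_prod_mul, integral_prod_mul]
    ring
  obtain ⟨iXJ, eXJ⟩ := key hint hJint hXJint
  obtain ⟨iJJ, eJJ⟩ := key hJint hJint (by simpa only [hJJ] using hJint)
  simp_rw [hJJ] at eJJ
  rw [hJt] at eXJ eJJ
  rw [hXJeq] at eXJ
  have bound : ∀ θ : ℝ, 0 < θ → 2 * (∫ x in A, X x ∂P) - 2 * ((∫ x, X x ∂P) * t) ≤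
      θ * C + t / θ := by
    intro θ hθ
    rw [← eXJ]
    have : ∫ z, (X z.1 - X z.2) * (J z.1 - J z.2) ∂(P.prod P) ≤
        ∫ z, (θ / 2 * (X z.1 - X z.2) ^ 2 + (2 * θ)⁻¹ * ((J z.1 - J z.2) * (J z.1 - J z.2)))
          ∂(P.prod P) := by
      refine integral_mono iXJ ((hDint.const_mul _).add (iJJ.const_mul _)) fun z => ?_
      have : 0 ≤ (2 * θ)⁻¹ * (θ * (X z.1 - X z.2) - (J z.1 - J z.2)) ^ 2 := by positivity
      have e : (2 * θ)⁻¹ * (θ * (X z.1 - X z.2) - (J z.1 - J z.2)) ^ 2 =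
        (θ / 2 * (X z.1 - X z.2) ^ 2 + (2 * θ)⁻¹ * ((J z.1 - J z.2) * (J z.1 - J z.2))) -
          (X z.1 - X z.2) * (J z.1 - J z.2) := by
        field_simp
        ring
      simp only
      linarith
    refine this.trans ?_
    rw [integral_add (hDint.const_mul _) (iJJ.const_mul _), integral_const_mul,
      integral_const_mul, eJJ]
    have a1 : θ / 2 * ∫ z, (X z.1 - X z.2) ^ 2 ∂(P.prod P) ≤ θ / 2 * (2 * C) := by gcongr
    have a2 : (2 * θ)⁻¹ * (2 * t - 2 * (t * t)) ≤ (2 * θ)⁻¹ * (2 * t) := by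
      gcongr; nlinarith
    have a3 : (2 * θ)⁻¹ * (2 * t) = t / θ := by field_simp
    linarith
  have hXA : t = 0 → ∫ x in A, X x ∂P = 0 := fun h0 => by
    have : P A = 0 := by rwa [ht, measureReal_eq_zero_iff] at h0
    rw [Measure.restrict_eq_zero.2 this, integral_zero_measure]
  rcases ht0.eq_or_lt with h0 | htpos
  · rw [hXA h0.symm, ← h0]; simp
  have hsq := Real.sq_sqrt ht0
  have hst : 0 < √t := Real.sqrt_pos.2 htpos
  suffices H : 2 * (∫ x in A, X x ∂P) - 2 * ((∫ x, X x ∂P) * t) ≤ 2 * (√t * √C) by linarith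
  refine le_of_forall_pos_le_add fun ε hε => ?_
  have hq : 0 < √C + ε / √t := by positivity
  refine (bound (√t / (√C + ε / √t)) (by positivity)).trans ?_
  have b1 : t / (√t / (√C + ε / √t)) = √t * √C + ε := by
    nth_rewrite 1 [← hsq]; field_simp
  have b2 : √t / (√C + ε / √t) * C ≤ √t * √C := by
    rw [div_mul_eq_mul_div, div_le_iff₀ hq, mul_assoc]
    gcongr
    nlinarith [Real.sq_sqrt hC, Real.sqrt_nonneg C, div_pos hε hst,
      mul_nonneg (Real.sqrt_nonneg C) (div_pos hε hst).le]
  linarith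

theorem lintegral_ofReal_eq_one {α : Type*} [MeasurableSpace α] {μ : Measure α} {f : α → ℝ}
    (hf : ∀ x, 0 ≤ f x) (hf1 : ∫ x, f x ∂μ = 1) : ∫⁻ x, ENNReal.ofReal (f x) ∂μ = 1 := by
  rw [← ofReal_integral_eq_lintegral_ofReal (Integrable.of_integral_ne_zero (by simp [hf1]))
    (Filter.Eventually.of_forall hf), hf1, ENNReal.ofReal_one]

namespace RadialLogConcave

variable {E : Type*} [NormedAddCommGroup E] [NormedSpace ℝ E] {φ : E → ℝ}

/-- Quantitative form of the varentropy bound: on any event `A`, the information content of a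
radial log-concave density exceeds its mean by at most `√(P A) * √dim`. -/
theorem neg_setIntegral_mul_log_le [FiniteDimensional ℝ E] [MeasurableSpace E]
    [BorelSpace E] (μ : Measure E) [μ.IsAddHaarMeasure] (h : RadialLogConcave φ)
    (hm : Measurable φ) (h1 : ∫ x, φ x ∂μ = 1)
    (hent : Integrable (fun x => φ x * log (φ x)) μ) {A : Set E} (hA : MeasurableSet A) :
    - ∫ x in A, φ x * log (φ x) ∂μ ≤
      (∫ x in A, φ x ∂μ) * (- ∫ x, φ x * log (φ x) ∂μ) +
        √(∫ x in A, φ x ∂μ) * √(Module.finrank ℝ E) := by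
  have hl1 := lintegral_ofReal_eq_one h.nonneg h1
  set P : Measure E := μ.withDensity fun x => ENNReal.ofReal (φ x) with hP
  have hφm : Measurable fun x => ENNReal.ofReal (φ x) := by fun_prop
  have : IsProbabilityMeasure P := ⟨by rw [hP, withDensity_apply _ MeasurableSet.univ]; simpa⟩
  have htr : ∀ x, (ENNReal.ofReal (φ x)).toReal = φ x := fun x => ENNReal.toReal_ofReal (h.nonneg x)
  have hint : ∀ (g : E → ℝ), ∫ x, g x ∂P = ∫ x, φ x * g x ∂μ := fun g => by
    rw [hP, integral_withDensity_eq_integral_toReal_smul hφm (by simp)]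
    simp [htr]
  have hsint : ∀ (g : E → ℝ), ∫ x in A, g x ∂P = ∫ x in A, φ x * g x ∂μ := fun g => by
    rw [hP, setIntegral_withDensity_eq_setIntegral_toReal_smul hφm (by simp) _ hA]
    simp [htr]
  have hXint : Integrable (fun x => -log (φ x)) P := by
    rw [hP, integrable_withDensity_iff_integrable_smul' hφm (by simp)]
    simpa [htr] using hent
  have hPA : P.real A = ∫ x in A, φ x ∂μ := by
    have := hsint (fun _ => 1)
    simpa using this
  have hmom : ∀ ε ∈ Ioo (0 : ℝ) 1,
      (∫⁻ x, ENNReal.ofReal (exp (ε * -log (φ x))) ∂P) *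
          (∫⁻ x, ENNReal.ofReal (exp (-(ε * -log (φ x)))) ∂P) ≤
        ENNReal.ofReal (exp (Module.finrank ℝ E * ε ^ 2 / (1 - ε))) := by
    intro ε hε
    have hs0 : 0 < 1 - ε := by linarith [hε.2]
    have key := h.lintegral_rpow_mul_lintegral_rpow_le μ hm hl1 hs0 (by linarith [hε.1])
    rw [mul_comm] at key
    refine le_trans (le_of_eq ?_) (key.trans (ENNReal.ofReal_le_ofReal ?_))
    · rw [hP, lintegral_withDensity_eq_lintegral_mul _ hφm (by fun_prop),
        lintegral_withDensity_eq_lintegral_mul _ hφm (by fun_prop)]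
      congr 1 <;> refine lintegral_congr fun x => ?_ <;>
        rw [Pi.mul_apply, ← ENNReal.ofReal_mul (h.nonneg x)] <;> congr 1 <;>
        rcases (h.nonneg x).eq_or_lt with h0 | h0
      · rw [← h0, Real.zero_rpow hs0.ne', zero_mul]
      · rw [sub_eq_add_neg, Real.rpow_add h0, Real.rpow_one, Real.rpow_def_of_pos h0]
        ring_nf
      · rw [← h0, zero_mul, zero_mul]
      · rw [sub_sub_cancel, Real.rpow_def_of_pos h0]
        ring_nf
    · rw [Real.rpow_def_of_pos (by positivity), sub_sub_cancel, Real.exp_le_exp, Real.log_inv,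
        Real.log_pow]
      have hl := Real.log_le_sub_one_of_pos (inv_pos.2 hs0)
      rw [Real.log_inv] at hl
      have e : (1 - ε)⁻¹ - 1 = ε / (1 - ε) := by field_simp; ring
      rw [e] at hl
      calc -(↑(Module.finrank ℝ E) * log (1 - ε)) * ε
          = (Module.finrank ℝ E * ε) * -log (1 - ε) := by ring
        _ ≤ (Module.finrank ℝ E * ε) * (ε / (1 - ε)) :=
          mul_le_mul_of_nonneg_left hl (mul_nonneg (Nat.cast_nonneg _) hε.1.le)
        _ = _ := by ring
  have hX : Measurable fun x => -log (φ x) := by fun_prop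
  have := setIntegral_le_of_lintegral_sq_sub_le hX hXint (Nat.cast_nonneg _)
    (lintegral_sq_sub_le_of_exp_moments hX hmom) hA
  rw [hsint, hint, hPA] at this
  simpa [integral_neg] using this

end RadialLogConcave

section Lipschitz

variable {E : Type*} [NormedAddCommGroup E] [InnerProductSpace ℝ E] [FiniteDimensional ℝ E]
  [MeasurableSpace E] [BorelSpace E] (μ : Measure E) [μ.IsAddHaarMeasure]

theorem LipschitzWith.addHaar_image_le {K : NNReal} {T : E → E} (hT : LipschitzWith K T)
    (A : Set E) : μ (T '' A) ≤ (K : ENNReal) ^ Module.finrank ℝ E * μ A := by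
  have hμ := Measure.isAddLeftInvariant_eq_smul μ
    (Measure.hausdorffMeasure (Module.finrank ℝ E : ℝ))
  have key := hT.hausdorffMeasure_image_le (d := Module.finrank ℝ E) (Nat.cast_nonneg _) A
  rw [ENNReal.rpow_natCast] at key
  rw [hμ, Measure.smul_apply, Measure.smul_apply, ENNReal.smul_def, ENNReal.smul_def, smul_eq_mul,
    smul_eq_mul, mul_left_comm]
  gcongr

/-- A density and its transport under a bi-Lipschitz map are comparable almost everywhere. -/
theorem density_comparison {K : NNReal} (T : E ≃ₜ E) (hT : LipschitzWith K T)
    (hT' : LipschitzWith K T.symm) {f φ : E → ℝ} (hf0 : ∀ x, 0 ≤ f x) (hφ0 : ∀ x, 0 ≤ φ x)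
    (hf : Measurable f) (hφ : Measurable φ)
    (hlaw : ∀ A, MeasurableSet A →
      ∫⁻ z in A, ENNReal.ofReal (f z) ∂μ = ∫⁻ w in T ⁻¹' A, ENNReal.ofReal (φ w) ∂μ) :
    ∀ᵐ z ∂μ, f z ≤ (K : ℝ) ^ Module.finrank ℝ E * φ (T.symm z) ∧
      φ (T.symm z) ≤ (K : ℝ) ^ Module.finrank ℝ E * f z := by
  set n := Module.finrank ℝ E
  have hTm : Measurable T := T.measurable
  have hSm : Measurable T.symm := T.symm.measurable
  have hφS : Measurable fun z => ENNReal.ofReal (φ (T.symm z)) := by fun_prop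
  have hmap1 : μ.map T ≤ ((K : ENNReal) ^ n) • μ := Measure.le_iff.2 fun A hA => by
    rw [Measure.map_apply hTm hA, ← T.image_symm]
    exact hT'.addHaar_image_le μ A
  have hmap2 : μ ≤ ((K : ENNReal) ^ n) • μ.map T := Measure.le_iff.2 fun A hA => by
    rw [Measure.smul_apply, Measure.map_apply hTm hA, smul_eq_mul]
    have := hT.addHaar_image_le μ (T ⁻¹' A)
    rwa [T.image_preimage] at this
  have hF : ∀ A, MeasurableSet A → ∫⁻ z in A, ENNReal.ofReal (f z) ∂μ =
      ∫⁻ z in A, ENNReal.ofReal (φ (T.symm z)) ∂(μ.map T) := fun A hA => by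
    rw [hlaw A hA, setLIntegral_map hA hφS hTm]
    simp
  have hKn : (K : ENNReal) ^ n = ENNReal.ofReal ((K : ℝ) ^ n) := by
    rw [ENNReal.ofReal_pow K.coe_nonneg, ENNReal.ofReal_coe_nnreal]
  have h1 : (fun z => ENNReal.ofReal (f z)) ≤ᵐ[μ]
      fun z => ENNReal.ofReal ((K : ℝ) ^ n * φ (T.symm z)) := by
    refine ae_le_of_forall_setLIntegral_le_of_sigmaFinite (by fun_prop) fun A hA _ => ?_
    simp_rw [ENNReal.ofReal_mul (pow_nonneg K.coe_nonneg n), ← hKn]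
    rw [hF A hA, lintegral_const_mul _ hφS, ← smul_eq_mul, ← lintegral_smul_measure,
      ← Measure.restrict_smul]
    exact lintegral_mono' (Measure.restrict_mono le_rfl hmap1) le_rfl
  have h2 : (fun z => ENNReal.ofReal (φ (T.symm z))) ≤ᵐ[μ]
      fun z => ENNReal.ofReal ((K : ℝ) ^ n * f z) := by
    refine ae_le_of_forall_setLIntegral_le_of_sigmaFinite hφS fun A hA _ => ?_
    simp_rw [ENNReal.ofReal_mul (pow_nonneg K.coe_nonneg n), ← hKn]
    rw [lintegral_const_mul _ (by fun_prop), hF A hA, ← smul_eq_mul, ← lintegral_smul_measure,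
      ← Measure.restrict_smul]
    exact lintegral_mono' (Measure.restrict_mono le_rfl hmap2) le_rfl
  filter_upwards [h1, h2] with z hz1 hz2
  exact ⟨(ENNReal.ofReal_le_ofReal_iff
      (mul_nonneg (pow_nonneg K.coe_nonneg n) (hφ0 _))).1 hz1,
    (ENNReal.ofReal_le_ofReal_iff (mul_nonneg (pow_nonneg K.coe_nonneg n) (hf0 _))).1 hz2⟩

end Lipschitz

section Packing

variable {E : Type*} [NormedAddCommGroup E] [NormedSpace ℝ E] [FiniteDimensional ℝ E]
  [MeasurableSpace E] [BorelSpace E] {ι : Type*}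

theorem card_le_of_disjoint_closedBalls (μ : Measure E) [μ.IsAddHaarMeasure]
    {s : Finset ι} {c : ι → E} {y : E} {ρ R : ℝ}
    (hρ : 0 < ρ) (hR : 0 ≤ R)
    (hdisj : (s : Set ι).PairwiseDisjoint fun j => closedBall (c j) ρ)
    (hc : ∀ j ∈ s, dist (c j) y ≤ R) :
    (s.card : ℝ) ≤ ((R + ρ) / ρ) ^ Module.finrank ℝ E := by
  have hsub : (⋃ j ∈ s, closedBall (c j) ρ) ⊆ closedBall y (R + ρ) :=
    iUnion₂_subset fun j hj => closedBall_subset_closedBall' (by linarith [hc j hj])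
  have h1 := measure_mono (μ := μ) hsub
  rw [measure_biUnion_finset hdisj fun j _ => measurableSet_closedBall] at h1
  rw [Finset.sum_congr rfl fun j _ => Measure.addHaar_closedBall' μ (c j) hρ.le,
    Measure.addHaar_closedBall' μ y (by positivity : 0 ≤ R + ρ), Finset.sum_const, nsmul_eq_mul,
    ← mul_assoc, ENNReal.mul_le_mul_iff_left (measure_closedBall_pos μ 0 one_pos).ne'
      measure_closedBall_lt_top.ne, ← ENNReal.ofReal_natCast,
    ← ENNReal.ofReal_mul (Nat.cast_nonneg _), ENNReal.ofReal_le_ofReal_iff (by positivity)] at h1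
  rw [div_pow, le_div_iff₀ (by positivity)]
  exact h1

theorem RadialLogConcave.le_indicator_add_setIntegral (μ : Measure E) [μ.IsAddHaarMeasure]
    {φ : E → ℝ} (h : RadialLogConcave φ)
    (hint : Integrable φ μ) {l : ℝ} (hl : 0 < l) (x : E) :
    φ x ≤ (if ‖x‖ ≤ l then φ 0 else 0) + (3 / l) ^ Module.finrank ℝ E *
      (μ.real (closedBall 0 1))⁻¹ * ∫ y in closedBall x l, φ y ∂μ := by
  have hn : 0 ≤ ∫ y in closedBall x l, φ y ∂μ := integral_nonneg h.nonneg
  split_ifs with hx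
  · have := h.antitone (x := 0) (y := x) (by simp)
    have : 0 ≤ (3 / l) ^ Module.finrank ℝ E *
      (μ.real (closedBall (0 : E) 1))⁻¹ * ∫ y in closedBall x l, φ y ∂μ := by positivity
    linarith
  rw [zero_add]
  push Not at hx
  have hx0 : 0 < ‖x‖ := hl.trans hx
  set c : E := (1 - l / 3 / ‖x‖) • x with hc
  have hcoef : 0 ≤ 1 - l / 3 / ‖x‖ := by
    rw [sub_nonneg, div_le_one hx0]; linarith
  have hcn : ‖c‖ = ‖x‖ - l / 3 := by
    rw [hc, norm_smul, Real.norm_of_nonneg hcoef, sub_mul, one_mul, div_mul_cancel₀ _ hx0.ne']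
  have hcx : dist c x = l / 3 := by
    rw [dist_eq_norm, hc, show (1 - l / 3 / ‖x‖) • x - x = -((l / 3 / ‖x‖) • x) by module,
      norm_neg, norm_smul, Real.norm_of_nonneg (by positivity), div_mul_cancel₀ _ hx0.ne']
  have hsub : closedBall c (l / 3) ⊆ closedBall x l :=
    closedBall_subset_closedBall' (by rw [hcx]; linarith)
  have hω : 0 < μ.real (closedBall (0 : E) 1) :=
    ENNReal.toReal_pos (measure_closedBall_pos μ 0 one_pos).ne' measure_closedBall_lt_top.ne
  have hvol : μ.real (closedBall c (l / 3)) =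
      (l / 3) ^ Module.finrank ℝ E * μ.real (closedBall 0 1) := by
    rw [Measure.real, Measure.addHaar_closedBall' μ _ (by positivity), ENNReal.toReal_mul,
      ENNReal.toReal_ofReal (by positivity), Measure.real]
  have h1 : (l / 3) ^ Module.finrank ℝ E * μ.real (closedBall 0 1) * φ x ≤
      ∫ y in closedBall x l, φ y ∂μ := by
    rw [← hvol]
    calc μ.real (closedBall c (l / 3)) * φ x = ∫ y in closedBall c (l / 3), φ x ∂μ := by
          rw [setIntegral_const, smul_eq_mul]
      _ ≤ ∫ y in closedBall c (l / 3), φ y ∂μ := by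
          refine setIntegral_mono_on (integrableOn_const measure_closedBall_lt_top.ne)
            hint.integrableOn measurableSet_closedBall fun y hy => h.antitone ?_
          have := norm_le_norm_add_norm_sub' y c
          rw [← dist_eq_norm] at this
          linarith [mem_closedBall.1 hy]
      _ ≤ _ := setIntegral_mono_set hint.integrableOn
          (Filter.Eventually.of_forall h.nonneg) hsub.eventuallyLE
  calc φ x = (3 / l) ^ Module.finrank ℝ E * (μ.real (closedBall (0 : E) 1))⁻¹ *
        ((l / 3) ^ Module.finrank ℝ E * μ.real (closedBall 0 1) * φ x) := by
        rw [show (3 / l) = (l / 3)⁻¹ by rw [inv_div], inv_pow]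
        field_simp
    _ ≤ _ := by gcongr

theorem RadialLogConcave.sum_le_of_card_le (μ : Measure E) [μ.IsAddHaarMeasure] {φ : E → ℝ}
    (h : RadialLogConcave φ) (h1 : ∫ y, φ y ∂μ = 1) {l : ℝ} (hl : 0 < l) {s : Finset ι} {x : ι → E} {N : ℝ}
    (hN : ∀ y, ((s.filter fun j => dist (x j) y ≤ l).card : ℝ) ≤ N) :
    ∑ j ∈ s, φ (x j) ≤ N * (φ 0 + (3 / l) ^ Module.finrank ℝ E *
      (μ.real (closedBall 0 1))⁻¹) := by
  have hint : Integrable φ μ := Integrable.of_integral_ne_zero (by simp [h1])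
  have hsum : ∑ j ∈ s, ∫ y in closedBall (x j) l, φ y ∂μ ≤ N := by
    simp_rw [← integral_indicator measurableSet_closedBall]
    rw [← integral_finsetSum _ fun j _ => hint.indicator measurableSet_closedBall]
    calc ∫ y, ∑ j ∈ s, (closedBall (x j) l).indicator φ y ∂μ ≤ ∫ y, N * φ y ∂μ := by
          refine integral_mono
            (integrable_finsetSum _ fun j _ => hint.indicator measurableSet_closedBall)
            (hint.const_mul N) fun y => ?_
          have e : ∑ j ∈ s, (closedBall (x j) l).indicator φ y =
              ((s.filter fun j => dist (x j) y ≤ l).card : ℝ) * φ y := by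
            rw [Finset.card_filter, Nat.cast_sum, Finset.sum_mul]
            refine Finset.sum_congr rfl fun j _ => ?_
            by_cases hj : dist (x j) y ≤ l <;> simp [indicator, dist_comm y, hj]
          beta_reduce
          rw [e]
          exact mul_le_mul_of_nonneg_right (hN y) (h.nonneg y)
      _ = N := by rw [integral_const_mul, h1, mul_one]
  have hcount : ∑ j ∈ s, (if ‖x j‖ ≤ l then φ 0 else 0) ≤ N * φ 0 := by
    rw [← Finset.sum_filter, Finset.sum_const, nsmul_eq_mul]
    have := hN 0
    simp only [dist_zero_right] at this
    exact mul_le_mul_of_nonneg_right this (h.nonneg 0)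
  calc ∑ j ∈ s, φ (x j) ≤ _ :=
        Finset.sum_le_sum fun j _ => h.le_indicator_add_setIntegral μ hint hl (x j)
    _ = ∑ j ∈ s, (if ‖x j‖ ≤ l then φ 0 else 0) + (3 / l) ^ Module.finrank ℝ E *
      (μ.real (closedBall 0 1))⁻¹ * ∑ j ∈ s, ∫ y in closedBall (x j) l, φ y ∂μ := by
        rw [Finset.sum_add_distrib, Finset.mul_sum]
    _ ≤ N * φ 0 + (3 / l) ^ Module.finrank ℝ E * (μ.real (closedBall 0 1))⁻¹ * N := by
        gcongr
    _ = _ := by ring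

end Packing

section Analysis

variable {E : Type*} [NormedAddCommGroup E] [NormedSpace ℝ E] [FiniteDimensional ℝ E]
  [MeasurableSpace E] [BorelSpace E]

theorem RadialLogConcave.integrable_mul_norm (μ : Measure E) [μ.IsAddHaarMeasure] {φ : E → ℝ}
    (h : RadialLogConcave φ) (hm : Measurable φ) (hint : Integrable φ μ)
    (hent : Integrable (fun x => φ x * log (φ x)) μ) :
    Integrable (fun x => φ x * ‖x‖) μ := by
  rcases subsingleton_or_nontrivial E with hE | hE
  · simp [Subsingleton.elim _ (0 : E)]
  by_cases hex : ∃ x₀, φ x₀ < φ 0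
  swap
  · push Not at hex
    have hc : φ = fun _ => φ 0 := funext fun x => le_antisymm (h.antitone (by simp)) (hex x)
    have h0 : φ 0 = 0 := by
      rw [hc, integrable_const_iff] at hint
      rcases hint with h0 | h0
      · exact h0
      · exact absurd h0.measure_univ_lt_top (by simp)
    rw [hc, h0]
    simp
  obtain ⟨x₀, hx₀⟩ := hex
  set r := ‖x₀‖ with hr
  have hr0 : 0 < r := norm_pos_iff.2 fun h0 => by simp [h0] at hx₀
  rcases (h.nonneg x₀).eq_or_lt with h00 | hx₀pos
  · refine (hint.const_mul r).mono' (by fun_prop) (Filter.Eventually.of_forall fun x => ?_)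
    rw [Real.norm_of_nonneg (mul_nonneg (h.nonneg x) (norm_nonneg x))]
    rcases le_total ‖x‖ r with hxr | hxr
    · nlinarith [h.nonneg x]
    · rw [le_antisymm ((h.antitone hxr).trans h00.ge) (h.nonneg x)]; simp
  set a := log (φ 0) - log (φ x₀) with ha
  have ha0 : 0 < a := sub_pos.2 (log_lt_log hx₀pos hx₀)
  have hg : Integrable (fun x => r * φ x + r / a * (log (φ 0) * φ x - φ x * log (φ x))) μ :=
    (hint.const_mul r).add (((hint.const_mul _).sub hent).const_mul _)
  refine hg.mono' (by fun_prop) (Filter.Eventually.of_forall fun x => ?_)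
  rw [Real.norm_of_nonneg (mul_nonneg (h.nonneg x) (norm_nonneg x))]
  rcases (h.nonneg x).eq_or_lt with h0 | hx
  · rw [← h0]; simp
  have hx1 : φ x ≤ φ 0 := h.antitone (by simp)
  have hφ0 : 0 < φ 0 := hx.trans_le hx1
  have hl : log (φ x) ≤ log (φ 0) := log_le_log hx hx1
  rcases le_total ‖x‖ r with hxr | hxr
  · have h1 : 0 ≤ log (φ 0) * φ x - φ x * log (φ x) := by nlinarith
    have h2 : 0 ≤ r / a * (log (φ 0) * φ x - φ x * log (φ x)) := by positivity
    nlinarith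
  · have hxp : 0 < ‖x‖ := hr0.trans_le hxr
    have hs1 : r / ‖x‖ ≤ 1 := (div_le_one hxp).2 hxr
    have hlc := h.logConcave 0 x (r / ‖x‖) ⟨by positivity, hs1⟩
    rw [smul_zero, zero_add, h.radial ((r / ‖x‖) • x) x₀ (by
      rw [norm_smul, Real.norm_of_nonneg (by positivity), div_mul_cancel₀ _ hxp.ne'])] at hlc
    have := log_le_log (by positivity) hlc
    rw [log_mul (by positivity) (by positivity), log_rpow hφ0, log_rpow hx] at this
    have h2 : a ≤ r / ‖x‖ * (log (φ 0) - log (φ x)) := by rw [ha]; linarith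
    have h3 : ‖x‖ ≤ r / a * (log (φ 0) - log (φ x)) := by
      rw [div_mul_eq_mul_div, le_div_iff₀ ha0]
      rw [div_mul_eq_mul_div, le_div_iff₀ hxp] at h2
      linarith
    have h4 := mul_le_mul_of_nonneg_left h3 hx.le
    have h5 : 0 ≤ r * φ x := by positivity
    linarith [show φ x * (r / a * (log (φ 0) - log (φ x))) =
      r / a * (log (φ 0) * φ x - φ x * log (φ x)) by ring]

theorem integrable_mul_log_sq {α : Type*} [MeasurableSpace α] {μ : Measure α} {φ u : α → ℝ}
    (h0 : ∀ x, 0 ≤ φ x) (hm : Measurable φ) (hu : Measurable u) (hu1 : ∀ x, 1 ≤ u x)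
    (hint : Integrable (fun x => φ x * u x) μ) :
    Integrable (fun x => φ x * log (u x) ^ 2) μ := by
  refine (hint.const_mul 4).mono' (by fun_prop) (Filter.Eventually.of_forall fun x => ?_)
  have hup : 0 < u x := one_pos.trans_le (hu1 x)
  rw [Real.norm_of_nonneg (mul_nonneg (h0 x) (sq_nonneg _))]
  have h1 : log (u x) ≤ 2 * √(u x) := by
    have := Real.log_le_self (Real.sqrt_nonneg (u x))
    rw [Real.log_sqrt hup.le] at this
    linarith
  have h2 : log (u x) ^ 2 ≤ 4 * u x := by
    have h3 := pow_le_pow_left₀ (Real.log_nonneg (hu1 x)) h1 2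
    rwa [mul_pow, Real.sq_sqrt hup.le, show (2 : ℝ) ^ 2 = 4 by norm_num] at h3
  nlinarith [h0 x, mul_le_mul_of_nonneg_left h2 (h0 x)]

theorem integrable_mul_of_sq {α : Type*} [MeasurableSpace α] {μ : Measure α} {φ L : α → ℝ}
    (h0 : ∀ x, 0 ≤ φ x) (hm : Measurable φ) (hL : Measurable L) (hφ : Integrable φ μ)
    (hφL : Integrable (fun x => φ x * L x ^ 2) μ) : Integrable (fun x => φ x * L x) μ := by
  refine (hφ.add hφL).mono' (by fun_prop) (Filter.Eventually.of_forall fun x => ?_)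
  rw [norm_mul, Real.norm_of_nonneg (h0 x), Real.norm_eq_abs, Pi.add_apply]
  have : |L x| ≤ 1 + L x ^ 2 := by
    rw [← sq_abs]; nlinarith [sq_nonneg (|L x| - 1), abs_nonneg (L x)]
  nlinarith [h0 x, mul_le_mul_of_nonneg_left this (h0 x)]

theorem integral_mul_le_sqrt_mul_sqrt {α : Type*} [MeasurableSpace α] {μ : Measure α}
    {φ L : α → ℝ} (h0 : ∀ x, 0 ≤ φ x) (hm : Measurable φ) (hL : Measurable L)
    (hφ : Integrable φ μ) (hφL : Integrable (fun x => φ x * L x ^ 2) μ) :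
    ∫ x, φ x * L x ∂μ ≤ √(∫ x, φ x ∂μ) * √(∫ x, φ x * L x ^ 2 ∂μ) := by
  have hφ1 := integrable_mul_of_sq h0 hm hL hφ hφL
  have key : ∀ c : ℝ, 0 ≤ (∫ x, φ x ∂μ) * (c * c) + (-2 * ∫ x, φ x * L x ∂μ) * c +
      ∫ x, φ x * L x ^ 2 ∂μ := by
    intro c
    have hnn : 0 ≤ ∫ x, φ x * (L x - c) ^ 2 ∂μ :=
      integral_nonneg fun x => mul_nonneg (h0 x) (sq_nonneg _)
    have e : (fun x => φ x * (L x - c) ^ 2) =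
        fun x => (c * c * φ x + (-2 * c) * (φ x * L x)) + φ x * L x ^ 2 := by
      funext x; ring
    have i1 : Integrable (fun x => c * c * φ x + (-2 * c) * (φ x * L x)) μ :=
      (hφ.const_mul _).add (hφ1.const_mul _)
    rw [e, integral_add i1 hφL, integral_add (hφ.const_mul _) (hφ1.const_mul _),
      integral_const_mul, integral_const_mul] at hnn
    linarith
  have hd := discrim_le_zero key
  rw [discrim] at hd
  rw [← Real.sqrt_mul (integral_nonneg h0)]
  exact Real.le_sqrt_of_sq_le (by nlinarith)

/-- Gibbs' inequality against a dominated family: if `p` is a probability vector, `p ≤ b` and the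
finite sums of `b` are at most `S`, then the finite sums of `p log (b / p)` are at most `log S`. -/
theorem sum_mul_log_div_le {ι : Type*} {p b : ι → ℝ} {S : ℝ} (hp0 : ∀ j, 0 ≤ p j)
    (hp1 : HasSum p 1) (hpb : ∀ j, p j ≤ b j) (hS : 0 < S)
    (hb : ∀ s : Finset ι, ∑ j ∈ s, b j ≤ S) (s : Finset ι) :
    ∑ j ∈ s, p j * log (b j / p j) ≤ log S := by
  have hterm : ∀ j, p j * log (b j / p j) ≤ p j * log S + (b j / S - p j) := by
    intro j
    rcases (hp0 j).eq_or_lt with h0 | hp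
    · rw [← h0]
      have : 0 ≤ b j / S := div_nonneg ((hp0 j).trans (hpb j)) hS.le
      simpa
    have hbp : 0 < b j := hp.trans_le (hpb j)
    have := Real.log_le_sub_one_of_pos (x := b j / p j / S) (by positivity)
    rw [Real.log_div (by positivity) hS.ne'] at this
    have h2 := mul_le_mul_of_nonneg_left this hp.le
    have e : p j * (b j / p j / S - 1) = b j / S - p j := by field_simp
    linarith
  have hnonneg : ∀ j, 0 ≤ p j * log (b j / p j) := by
    intro j
    rcases (hp0 j).eq_or_lt with h0 | hp
    · rw [← h0]; simp
    · exact mul_nonneg hp.le (Real.log_nonneg ((one_le_div hp).2 (hpb j)))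
  have hlim : Filter.Tendsto (fun t : Finset ι => (∑ j ∈ t, p j) * log S + (1 - ∑ j ∈ t, p j))
      Filter.atTop (nhds (1 * log S + (1 - 1))) :=
    (Filter.Tendsto.mul_const _ hp1).add (Filter.Tendsto.const_sub _ hp1)
  rw [one_mul, sub_self, add_zero] at hlim
  refine ge_of_tendsto hlim ?_
  filter_upwards [Filter.eventually_ge_atTop s] with t ht
  calc ∑ j ∈ s, p j * log (b j / p j) ≤ ∑ j ∈ t, p j * log (b j / p j) :=
        Finset.sum_le_sum_of_subset_of_nonneg ht fun j _ _ => hnonneg j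
    _ ≤ ∑ j ∈ t, (p j * log S + (b j / S - p j)) := Finset.sum_le_sum fun j _ => hterm j
    _ = (∑ j ∈ t, p j) * log S + ((∑ j ∈ t, b j) / S - ∑ j ∈ t, p j) := by
        rw [Finset.sum_add_distrib, Finset.sum_sub_distrib, Finset.sum_mul, Finset.sum_div]
    _ ≤ _ := by
        have := (div_le_one hS).2 (hb t)
        linarith

end Analysis

section ChangeOfVariables

variable {E : Type*} [MeasurableSpace E] {μ : Measure E} {f φ : E → ℝ}

theorem setIntegral_withDensity_ofReal (hf0 : ∀ x, 0 ≤ f x) (hf : Measurable f) {A : Set E}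
    (hA : MeasurableSet A) (k : E → ℝ) :
    ∫ z in A, k z ∂(μ.withDensity fun z => ENNReal.ofReal (f z)) = ∫ z in A, f z * k z ∂μ := by
  rw [setIntegral_withDensity_eq_setIntegral_toReal_smul (by fun_prop)
    (Filter.Eventually.of_forall fun _ => ENNReal.ofReal_lt_top) _ hA]
  simp [ENNReal.toReal_ofReal (hf0 _)]

theorem integrable_withDensity_ofReal_iff (hf0 : ∀ x, 0 ≤ f x) (hf : Measurable f) (k : E → ℝ) :
    Integrable k (μ.withDensity fun z => ENNReal.ofReal (f z)) ↔
      Integrable (fun z => f z * k z) μ := by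
  rw [integrable_withDensity_iff_integrable_smul' (by fun_prop)
    (Filter.Eventually.of_forall fun _ => ENNReal.ofReal_lt_top)]
  simp [ENNReal.toReal_ofReal (hf0 _)]

variable [TopologicalSpace E] [BorelSpace E] {T : E ≃ₜ E}

theorem map_withDensity_of_setLIntegral_eq
    (hlaw : ∀ A, MeasurableSet A →
      ∫⁻ z in A, ENNReal.ofReal (f z) ∂μ = ∫⁻ w in T ⁻¹' A, ENNReal.ofReal (φ w) ∂μ) :
    (μ.withDensity fun w => ENNReal.ofReal (φ w)).map T =
      μ.withDensity fun z => ENNReal.ofReal (f z) := by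
  ext A hA
  rw [Measure.map_apply T.measurable hA, withDensity_apply _ (T.measurable hA),
    withDensity_apply _ hA, hlaw A hA]

theorem setIntegral_mul_eq_preimage (hf0 : ∀ x, 0 ≤ f x) (hφ0 : ∀ x, 0 ≤ φ x)
    (hf : Measurable f) (hφ : Measurable φ)
    (hlaw : ∀ A, MeasurableSet A →
      ∫⁻ z in A, ENNReal.ofReal (f z) ∂μ = ∫⁻ w in T ⁻¹' A, ENNReal.ofReal (φ w) ∂μ)
    {A : Set E} (hA : MeasurableSet A) (k : E → ℝ) :
    ∫ z in A, f z * k z ∂μ = ∫ w in T ⁻¹' A, φ w * k (T w) ∂μ := by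
  rw [← setIntegral_withDensity_ofReal hf0 hf hA, ← map_withDensity_of_setLIntegral_eq hlaw,
    T.measurableEmbedding.setIntegral_map,
    setIntegral_withDensity_ofReal hφ0 hφ (T.measurable hA) fun w => k (T w)]

theorem integrable_mul_comp (hf0 : ∀ x, 0 ≤ f x) (hφ0 : ∀ x, 0 ≤ φ x)
    (hf : Measurable f) (hφ : Measurable φ)
    (hlaw : ∀ A, MeasurableSet A →
      ∫⁻ z in A, ENNReal.ofReal (f z) ∂μ = ∫⁻ w in T ⁻¹' A, ENNReal.ofReal (φ w) ∂μ)
    {k : E → ℝ} (hk : Integrable (fun z => f z * k z) μ) :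
    Integrable (fun w => φ w * k (T w)) μ := by
  rw [← integrable_withDensity_ofReal_iff hf0 hf, ← map_withDensity_of_setLIntegral_eq hlaw,
    T.measurableEmbedding.integrable_map_iff] at hk
  exact (integrable_withDensity_ofReal_iff hφ0 hφ _).1 hk

end ChangeOfVariables

section Separation

variable {E : Type*} [NormedAddCommGroup E] [InnerProductSpace ℝ E] [FiniteDimensional ℝ E]
  [MeasurableSpace E] [BorelSpace E] {ι : Type*}

theorem LipschitzWith.quasiMeasurePreserving (μ : Measure E) [μ.IsAddHaarMeasure] {K : NNReal}
    (T : E ≃ₜ E) (hT' : LipschitzWith K T.symm) : Measure.QuasiMeasurePreserving T μ μ := by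
  refine ⟨T.measurable, Measure.AbsolutelyContinuous.mk fun A hA h0 => ?_⟩
  rw [Measure.map_apply T.measurable hA, ← T.image_symm]
  exact le_antisymm ((hT'.addHaar_image_le μ A).trans (by simp [h0])) zero_le

theorem card_filter_dist_le {K : NNReal} (hK : 1 ≤ K) {lam : ℝ} (hlam : 0 < lam)
    {T : ι → E ≃ₜ E} (hT : ∀ i, LipschitzWith K (T i)) (hT' : ∀ i, LipschitzWith K (T i).symm)
    (hdisj : Pairwise fun i j =>
      Disjoint (T i '' closedBall 0 lam) (T j '' closedBall 0 lam))
    (i : ι) (w y : E) (s : Finset ι) :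
    ((s.filter fun j => dist ((T i).symm (T j w)) y ≤ lam).card : ℝ) ≤
      (1 + (K : ℝ) ^ 2 + ((K : ℝ) ^ 2) ^ 2 * ‖w‖ / lam) ^ Module.finrank ℝ E := by
  have hK0 : (0 : ℝ) < K := by exact_mod_cast one_pos.trans_le hK
  have hG : ∀ j u v, dist ((T i).symm (T j u)) ((T i).symm (T j v)) ≤ (K : ℝ) ^ 2 * dist u v :=
    fun j u v => by
      have h1 := (hT' i).dist_le_mul (T j u) (T j v)
      have h2 := (hT j).dist_le_mul u v
      nlinarith
  have key := card_le_of_disjoint_closedBalls (volume : Measure E)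
    (s := s.filter fun j => dist ((T i).symm (T j w)) y ≤ lam)
    (c := fun j => (T i).symm (T j 0)) (y := y) (ρ := lam / (K : ℝ) ^ 2)
    (R := (K : ℝ) ^ 2 * ‖w‖ + lam) (by positivity) (by positivity) ?_ ?_
  · convert key using 2
    field_simp
    ring
  · have hsub : ∀ j, closedBall ((T i).symm (T j 0)) (lam / (K : ℝ) ^ 2) ⊆
        (T i).symm '' (T j '' closedBall 0 lam) := fun j x hx => by
      refine ⟨T i x, ⟨(T j).symm (T i x), ?_, by simp⟩, by simp⟩
      have h1 := (hT' j).dist_le_mul (T i x) (T i ((T i).symm (T j 0)))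
      have h2 := (hT i).dist_le_mul x ((T i).symm (T j 0))
      simp only [Homeomorph.apply_symm_apply, Homeomorph.symm_apply_apply] at h1 h2
      rw [mem_closedBall, le_div_iff₀ (by positivity)] at hx
      rw [mem_closedBall]
      nlinarith
    intro j _ k _ hjk
    exact ((disjoint_image_iff (T i).symm.injective).2 (hdisj hjk)).mono (hsub j) (hsub k)
  · intro j hj
    have h1 := hG j 0 w
    rw [dist_zero_left] at h1
    linarith [(Finset.mem_filter.1 hj).2,
      dist_triangle ((T i).symm (T j 0)) ((T i).symm (T j w)) y]

end Separation

section Mixture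

variable {E : Type*} [NormedAddCommGroup E] [InnerProductSpace ℝ E] [FiniteDimensional ℝ E]
  [MeasurableSpace E] [BorelSpace E] {ι : Type*}

/-- Bi-Lipschitz images, with densities `f i` and weights `p i`, of a radial log-concave
probability density `φ`, such that the images of the ball of radius `lam` are disjoint. -/
structure SeparatedMixture (K : NNReal) (lam : ℝ) (p : ι → ℝ) (φ : E → ℝ) (T : ι → E ≃ₜ E)
    (f : ι → E → ℝ) : Prop where
  one_le : 1 ≤ K
  lam_pos : 0 < lam
  p_nonneg : ∀ i, 0 ≤ p i
  hasSum_p : HasSum p 1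
  radial : RadialLogConcave φ
  measurable_base : Measurable φ
  integral_base : ∫ w, φ w = 1
  lipschitz : ∀ i, LipschitzWith K (T i)
  lipschitz_symm : ∀ i, LipschitzWith K (T i).symm
  disjoint : Pairwise fun i j => Disjoint (T i '' closedBall 0 lam) (T j '' closedBall 0 lam)
  nonneg : ∀ i z, 0 ≤ f i z
  measurable : ∀ i, Measurable (f i)
  law : ∀ i A, MeasurableSet A →
    ∫⁻ z in A, ENNReal.ofReal (f i z) = ∫⁻ w in T i ⁻¹' A, ENNReal.ofReal (φ w)

/-- The density of a mixture. -/
noncomputable def mixture (p : ι → ℝ) (f : ι → E → ℝ) (z : E) : ℝ := ∑' i, p i * f i z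

/-- The contribution of the component `j` to the equivocation of the label given the mixture. -/
noncomputable def equivocation (p : ι → ℝ) (f : ι → E → ℝ) (j : ι) (z : E) : ℝ :=
  f j z * (p j * log (mixture p f z / (p j * f j z)))

namespace SeparatedMixture

variable {K : NNReal} {lam : ℝ} {p : ι → ℝ} {φ : E → ℝ} {T : ι → E ≃ₜ E} {f : ι → E → ℝ}

theorem integrable_base (h : SeparatedMixture K lam p φ T f) : Integrable φ :=
  Integrable.of_integral_ne_zero (by simp [h.integral_base])

theorem setIntegral_eq (h : SeparatedMixture K lam p φ T f) (i : ι) {A : Set E}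
    (hA : MeasurableSet A) : ∫ z in A, f i z = ∫ w in T i ⁻¹' A, φ w := by
  have := setIntegral_mul_eq_preimage (h.nonneg i) h.radial.nonneg (h.measurable i)
    h.measurable_base (h.law i) hA fun _ => 1
  simpa using this

theorem integral_eq_one (h : SeparatedMixture K lam p φ T f) (i : ι) : ∫ z, f i z = 1 := by
  have := h.setIntegral_eq i MeasurableSet.univ
  simpa [h.integral_base] using this

theorem integrable (h : SeparatedMixture K lam p φ T f) (i : ι) : Integrable (f i) :=
  Integrable.of_integral_ne_zero (by simp [h.integral_eq_one])

theorem mixture_nonneg (h : SeparatedMixture K lam p φ T f) (z : E) : 0 ≤ mixture p f z :=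
  tsum_nonneg fun i => mul_nonneg (h.p_nonneg i) (h.nonneg i z)

/-- The bound on the number of relevant components times the bound on `φ` from sphere packing. -/
theorem sum_comp_le (h : SeparatedMixture K lam p φ T f) (i : ι) (w : E) (s : Finset ι) :
    ∑ j ∈ s, φ ((T i).symm (T j w)) ≤
      (1 + (K : ℝ) ^ 2 + ((K : ℝ) ^ 2) ^ 2 * ‖w‖ / lam) ^ Module.finrank ℝ E *
        (φ 0 + (3 / lam) ^ Module.finrank ℝ E * (volume.real (closedBall (0 : E) 1))⁻¹) :=
  h.radial.sum_le_of_card_le volume h.integral_base h.lam_pos fun y =>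
    card_filter_dist_le h.one_le h.lam_pos h.lipschitz h.lipschitz_symm h.disjoint i w y s

theorem integrable_base_mul_log_sq (h : SeparatedMixture K lam p φ T f)
    (hφ : Integrable fun w => φ w * log (φ w)) :
    Integrable fun w => φ w * log (1 + (K : ℝ) ^ 2 + ((K : ℝ) ^ 2) ^ 2 * ‖w‖ / lam) ^ 2 := by
  have hlam := h.lam_pos
  refine integrable_mul_log_sq h.radial.nonneg h.measurable_base (by fun_prop) (fun w => ?_) ?_
  · have : 0 ≤ (K : ℝ) ^ 2 + ((K : ℝ) ^ 2) ^ 2 * ‖w‖ / lam := by positivity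
    linarith
  · have h1 := h.radial.integrable_mul_norm volume h.measurable_base h.integrable_base hφ
    refine ((h.integrable_base.const_mul (1 + (K : ℝ) ^ 2)).add
      (h1.const_mul (((K : ℝ) ^ 2) ^ 2 / lam))).congr (Filter.Eventually.of_forall fun w => ?_)
    simp only [Pi.add_apply]
    ring

theorem integrable_base_mul_log (h : SeparatedMixture K lam p φ T f)
    (hφ : Integrable fun w => φ w * log (φ w)) :
    Integrable fun w => φ w * log (1 + (K : ℝ) ^ 2 + ((K : ℝ) ^ 2) ^ 2 * ‖w‖ / lam) :=
  integrable_mul_of_sq h.radial.nonneg h.measurable_base (by fun_prop) h.integrable_base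
    (h.integrable_base_mul_log_sq hφ)

variable [Countable ι]

theorem ae_comparison (h : SeparatedMixture K lam p φ T f) :
    ∀ᵐ z, ∀ i, f i z ≤ (K : ℝ) ^ Module.finrank ℝ E * φ ((T i).symm z) ∧
      φ ((T i).symm z) ≤ (K : ℝ) ^ Module.finrank ℝ E * f i z :=
  ae_all_iff.2 fun i => density_comparison volume (T i) (h.lipschitz i) (h.lipschitz_symm i)
    (h.nonneg i) h.radial.nonneg (h.measurable i) h.measurable_base (h.law i)

theorem ae_hasSum (h : SeparatedMixture K lam p φ T f) :
    ∀ᵐ z, HasSum (fun i => p i * f i z) (mixture p f z) := by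
  filter_upwards [h.ae_comparison] with z hz
  refine (Summable.of_nonneg_of_le (fun i => mul_nonneg (h.p_nonneg i) (h.nonneg i z))
    (fun i => ?_) (h.hasSum_p.summable.mul_right ((K : ℝ) ^ Module.finrank ℝ E * φ 0))).hasSum
  exact mul_le_mul_of_nonneg_left ((hz i).1.trans
    (mul_le_mul_of_nonneg_left (h.radial.antitone (by simp)) (by positivity))) (h.p_nonneg i)

theorem ae_mul_le_mixture (h : SeparatedMixture K lam p φ T f) :
    ∀ᵐ z, ∀ i, p i * f i z ≤ mixture p f z := by
  filter_upwards [h.ae_hasSum] with z hz i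
  exact le_hasSum hz i fun j _ => mul_nonneg (h.p_nonneg j) (h.nonneg j z)

theorem integral_mixture (h : SeparatedMixture K lam p φ T f) : ∫ z, mixture p f z = 1 := by
  have key := hasSum_integral_of_summable_integral_norm (F := fun i z => p i * f i z)
    (μ := volume) (fun i => (h.integrable i).const_mul _) (by
      simp_rw [norm_mul, Real.norm_of_nonneg (h.p_nonneg _), Real.norm_of_nonneg (h.nonneg _ _),
        integral_const_mul, h.integral_eq_one, mul_one]
      exact h.hasSum_p.summable)
  simp_rw [integral_const_mul, h.integral_eq_one, mul_one] at key
  exact key.unique h.hasSum_p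

theorem integrable_mixture (h : SeparatedMixture K lam p φ T f) : Integrable (mixture p f) :=
  Integrable.of_integral_ne_zero (by simp [h.integral_mixture])

theorem ae_equivocation_nonneg (h : SeparatedMixture K lam p φ T f) :
    ∀ᵐ z, ∀ j, 0 ≤ equivocation p f j z := by
  filter_upwards [h.ae_mul_le_mixture] with z hz j
  rw [equivocation, ← mul_assoc, mul_comm (f j z)]
  rcases (mul_nonneg (h.p_nonneg j) (h.nonneg j z)).eq_or_lt with h0 | h0
  · rw [← h0, zero_mul]
  · exact mul_nonneg h0.le (Real.log_nonneg ((one_le_div h0).2 (hz j)))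

theorem ae_equivocation_le (h : SeparatedMixture K lam p φ T f) :
    ∀ᵐ z, ∀ j, equivocation p f j z ≤ mixture p f z - p j * f j z := by
  filter_upwards [h.ae_mul_le_mixture] with z hz j
  rw [equivocation, ← mul_assoc, mul_comm (f j z)]
  rcases (mul_nonneg (h.p_nonneg j) (h.nonneg j z)).eq_or_lt with h0 | h0
  · rw [← h0, zero_mul, sub_zero]
    exact h.mixture_nonneg z
  · have h1 := Real.log_le_sub_one_of_pos (div_pos (h0.trans_le (hz j)) h0)
    have h2 := mul_le_mul_of_nonneg_left h1 h0.le
    rwa [mul_sub_one, mul_div_cancel₀ _ h0.ne'] at h2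

theorem ae_equivocation_eq (h : SeparatedMixture K lam p φ T f) :
    ∀ᵐ z, ∀ j, equivocation p f j z = p j * f j z * log (mixture p f z) -
      p j * (f j z * log (f j z)) - p j * log (p j) * f j z := by
  filter_upwards [h.ae_mul_le_mixture] with z hz j
  rw [equivocation]
  rcases (h.p_nonneg j).eq_or_lt with h0 | hp
  · simp [← h0]
  rcases (h.nonneg j z).eq_or_lt with h0 | hf
  · simp [← h0]
  rw [Real.log_div (((mul_pos hp hf).trans_le (hz j)).ne') (by positivity),
    Real.log_mul hp.ne' hf.ne']
  ring

theorem integrable_mul_log_mixture (h : SeparatedMixture K lam p φ T f)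
    (hent : Integrable fun z => mixture p f z * log (mixture p f z)) (j : ι) :
    Integrable fun z => p j * f j z * log (mixture p f z) := by
  refine hent.mono (((h.measurable j).const_mul _).aestronglyMeasurable.mul
    (Real.measurable_log.comp_aemeasurable
      h.integrable_mixture.aemeasurable).aestronglyMeasurable) ?_
  filter_upwards [h.ae_mul_le_mixture] with z hz
  rw [norm_mul (p j * f j z), norm_mul (mixture p f z)]
  refine mul_le_mul_of_nonneg_right ?_ (norm_nonneg (log (mixture p f z)))
  rw [Real.norm_of_nonneg (mul_nonneg (h.p_nonneg j) (h.nonneg j z)),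
    Real.norm_of_nonneg (h.mixture_nonneg z)]
  exact hz j

theorem integrable_equivocation (h : SeparatedMixture K lam p φ T f)
    (hent : Integrable fun z => mixture p f z * log (mixture p f z))
    (hent' : ∀ i, Integrable fun z => f i z * log (f i z)) (j : ι) :
    Integrable (equivocation p f j) := by
  refine ((((h.integrable_mul_log_mixture hent j).sub ((hent' j).const_mul (p j))).sub
    ((h.integrable j).const_mul (p j * log (p j))))).congr ?_
  filter_upwards [h.ae_equivocation_eq] with z hz
  exact (hz j).symm

theorem sum_setIntegral_equivocation_le (h : SeparatedMixture K lam p φ T f)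
    (hg : ∀ i, Integrable (equivocation p f i)) (s : Finset ι) :
    ∑ j ∈ s, ∫ z in T j '' closedBall 0 lam, equivocation p f j z ≤
      1 - (∑ j ∈ s, p j) * ∫ w in closedBall 0 lam, φ w := by
  have hA : ∀ j, MeasurableSet (T j '' closedBall 0 lam) := fun j =>
    (T j).measurableEmbedding.measurableSet_image.2 measurableSet_closedBall
  have h1 : ∀ j, ∫ z in T j '' closedBall 0 lam, equivocation p f j z ≤
      (∫ z in T j '' closedBall 0 lam, mixture p f z) - p j * ∫ w in closedBall 0 lam, φ w := by
    intro j
    have e : ∫ w in closedBall 0 lam, φ w = ∫ z in T j '' closedBall 0 lam, f j z := by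
      rw [h.setIntegral_eq j (hA j), preimage_image_eq _ (T j).injective]
    rw [e, ← integral_const_mul, ← integral_sub h.integrable_mixture.integrableOn
      ((h.integrable j).const_mul _).integrableOn]
    refine setIntegral_mono_ae (hg j).integrableOn
      (h.integrable_mixture.sub ((h.integrable j).const_mul _)).integrableOn ?_
    filter_upwards [h.ae_equivocation_le] with z hz using hz j
  have h2 : ∑ j ∈ s, ∫ z in T j '' closedBall 0 lam, mixture p f z ≤ 1 := by
    rw [← integral_biUnion_finset s (fun j _ => hA j) (fun i _ j _ hij => h.disjoint hij)
      fun j _ => h.integrable_mixture.integrableOn, ← h.integral_mixture]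
    exact setIntegral_le_integral h.integrable_mixture
      (Filter.Eventually.of_forall h.mixture_nonneg)
  calc _ ≤ _ := Finset.sum_le_sum fun j _ => h1 j
    _ ≤ _ := by rw [Finset.sum_sub_distrib, Finset.sum_mul]; linarith

theorem ae_sum_log_div_le (h : SeparatedMixture K lam p φ T f) :
    ∀ᵐ w, 0 < φ w → ∀ s : Finset ι,
      ∑ j ∈ s, p j * log (mixture p f (T j w) / (p j * f j (T j w))) ≤
        log (((K : ℝ) ^ 2) ^ Module.finrank ℝ E *
          ((1 + (K : ℝ) ^ 2 + ((K : ℝ) ^ 2) ^ 2 * ‖w‖ / lam) ^ Module.finrank ℝ E *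
          (φ 0 + (3 / lam) ^ Module.finrank ℝ E *
            (volume.real (closedBall (0 : E) 1))⁻¹)) / φ w) := by
  set n := Module.finrank ℝ E
  set M := φ 0 + (3 / lam) ^ n * (volume.real (closedBall (0 : E) 1))⁻¹ with hM
  have hK : (0 : ℝ) < K := by exact_mod_cast one_pos.trans_le h.one_le
  have hω : 0 < volume.real (closedBall (0 : E) 1) :=
    ENNReal.toReal_pos (measure_closedBall_pos _ 0 one_pos).ne' measure_closedBall_lt_top.ne
  have hlam := h.lam_pos
  have hM0 : 0 < M := add_pos_of_nonneg_of_pos (h.radial.nonneg 0) (by positivity)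
  have hae : ∀ᵐ w, ∀ j, (∀ i, f i (T j w) ≤ (K : ℝ) ^ n * φ ((T i).symm (T j w)) ∧
      φ ((T i).symm (T j w)) ≤ (K : ℝ) ^ n * f i (T j w)) ∧
      HasSum (fun i => p i * f i (T j w)) (mixture p f (T j w)) :=
    ae_all_iff.2 fun j => (LipschitzWith.quasiMeasurePreserving volume (T j)
      (h.lipschitz_symm j)).ae (h.ae_comparison.and h.ae_hasSum)
  filter_upwards [hae] with w hw hφ s
  set N := (1 + (K : ℝ) ^ 2 + ((K : ℝ) ^ 2) ^ 2 * ‖w‖ / lam) ^ n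
  have hN : 0 < N := by positivity
  have hlow : ∀ j, φ w ≤ (K : ℝ) ^ n * f j (T j w) := fun j => by
    simpa using ((hw j).1 j).2
  have hfpos : ∀ j, 0 < f j (T j w) := fun j =>
    pos_of_mul_pos_right (hφ.trans_le (hlow j)) (by positivity)
  simp_rw [mul_comm (p _) (f _ _), ← div_div]
  refine sum_mul_log_div_le (b := fun j => mixture p f (T j w) / f j (T j w)) h.p_nonneg
    h.hasSum_p (fun j => ?_) (by positivity) (fun t => ?_) s
  · rw [le_div_iff₀ (hfpos j)]
    exact le_hasSum (hw j).2 j fun i _ => mul_nonneg (h.p_nonneg i) (h.nonneg i _)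
  · have hb : ∀ j, HasSum (fun i => p i * (f i (T j w) / f j (T j w)))
        (mixture p f (T j w) / f j (T j w)) := fun j => by
      simpa [mul_div_assoc] using (hw j).2.div_const (f j (T j w))
    have hS := hasSum_sum (s := t) fun j _ => hb j
    refine hasSum_le (fun i => ?_) hS (by
      simpa using h.hasSum_p.mul_right (((K : ℝ) ^ 2) ^ n * (N * M) / φ w))
    rw [← Finset.mul_sum]
    refine mul_le_mul_of_nonneg_left ?_ (h.p_nonneg i)
    have hterm : ∀ j, f i (T j w) / f j (T j w) ≤
        ((K : ℝ) ^ 2) ^ n / φ w * φ ((T i).symm (T j w)) := fun j => by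
      rw [div_le_iff₀ (hfpos j), div_mul_eq_mul_div, div_mul_eq_mul_div, le_div_iff₀ hφ]
      calc f i (T j w) * φ w ≤
            ((K : ℝ) ^ n * φ ((T i).symm (T j w))) * ((K : ℝ) ^ n * f j (T j w)) :=
            mul_le_mul ((hw j).1 i).1 (hlow j) hφ.le
              (mul_nonneg (by positivity) (h.radial.nonneg _))
        _ = _ := by ring
    calc _ ≤ _ := Finset.sum_le_sum fun j _ => hterm j
      _ ≤ ((K : ℝ) ^ 2) ^ n / φ w * (N * M) := by
        rw [← Finset.mul_sum]
        exact mul_le_mul_of_nonneg_left (h.sum_comp_le i w t) (by positivity)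
      _ = _ := by ring

theorem sum_setIntegral_compl_equivocation_le (h : SeparatedMixture K lam p φ T f)
    (hg : ∀ i, Integrable (equivocation p f i)) (hφ : Integrable fun w => φ w * log (φ w))
    (s : Finset ι) :
    ∑ j ∈ s, ∫ z in (T j '' closedBall 0 lam)ᶜ, equivocation p f j z ≤
      log (((K : ℝ) ^ 2) ^ Module.finrank ℝ E * (φ 0 + (3 / lam) ^ Module.finrank ℝ E *
        (volume.real (closedBall (0 : E) 1))⁻¹)) * (∫ w in (closedBall 0 lam)ᶜ, φ w) +
      Module.finrank ℝ E * (∫ w in (closedBall 0 lam)ᶜ,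
        φ w * log (1 + (K : ℝ) ^ 2 + ((K : ℝ) ^ 2) ^ 2 * ‖w‖ / lam)) -
      ∫ w in (closedBall 0 lam)ᶜ, φ w * log (φ w) := by
  set n := Module.finrank ℝ E
  set M := φ 0 + (3 / lam) ^ n * (volume.real (closedBall (0 : E) 1))⁻¹ with hM
  have hK : (0 : ℝ) < K := by exact_mod_cast one_pos.trans_le h.one_le
  have hω : 0 < volume.real (closedBall (0 : E) 1) :=
    ENNReal.toReal_pos (measure_closedBall_pos _ 0 one_pos).ne' measure_closedBall_lt_top.ne
  have hlam := h.lam_pos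
  have hM0 : 0 < M := add_pos_of_nonneg_of_pos (h.radial.nonneg 0) (by positivity)
  have hA : ∀ j, MeasurableSet (T j '' closedBall 0 lam)ᶜ := fun j =>
    ((T j).measurableEmbedding.measurableSet_image.2 measurableSet_closedBall).compl
  have e : ∀ j, ∫ z in (T j '' closedBall 0 lam)ᶜ, equivocation p f j z =
      ∫ w in (closedBall 0 lam)ᶜ, φ w *
        (p j * log (mixture p f (T j w) / (p j * f j (T j w)))) := fun j => by
    have := setIntegral_mul_eq_preimage (h.nonneg j) h.radial.nonneg (h.measurable j)
      h.measurable_base (h.law j) (hA j) fun z => p j * log (mixture p f z / (p j * f j z))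
    rwa [preimage_compl, preimage_image_eq _ (T j).injective] at this
  have hi : ∀ j, Integrable fun w => φ w *
      (p j * log (mixture p f (T j w) / (p j * f j (T j w)))) := fun j =>
    integrable_mul_comp (h.nonneg j) h.radial.nonneg (h.measurable j) h.measurable_base (h.law j)
      (hg j)
  have i1 := h.integrable_base.const_mul (log (((K : ℝ) ^ 2) ^ n * M))
  have i2 := (h.integrable_base_mul_log hφ).const_mul (n : ℝ)
  have i3 : Integrable fun w => log (((K : ℝ) ^ 2) ^ n * M) * φ w +
      n * (φ w * log (1 + (K : ℝ) ^ 2 + ((K : ℝ) ^ 2) ^ 2 * ‖w‖ / lam)) := i1.add i2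
  rw [Finset.sum_congr rfl fun j _ => e j, ← integral_finsetSum _ fun j _ => (hi j).integrableOn,
    ← integral_const_mul, ← integral_const_mul, ← integral_add i1.integrableOn i2.integrableOn,
    ← integral_sub i3.integrableOn hφ.integrableOn]
  refine setIntegral_mono_ae (integrable_finsetSum _ fun j _ => hi j).integrableOn
    (i3.sub hφ).integrableOn ?_
  filter_upwards [h.ae_sum_log_div_le] with w hw
  rw [← Finset.mul_sum]
  rcases (h.radial.nonneg w).eq_or_lt with h0 | hpos
  · simp [← h0]
  · have h1 := mul_le_mul_of_nonneg_left (hw hpos s) hpos.le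
    have hL : 0 < 1 + (K : ℝ) ^ 2 + ((K : ℝ) ^ 2) ^ 2 * ‖w‖ / lam := by positivity
    rw [Real.log_div (by positivity) hpos.ne', mul_left_comm, Real.log_mul (by positivity)
      (by positivity), Real.log_pow] at h1
    linarith

/-- The bound on the equivocation `H(X|Z)`, by finite sums of its components. -/
theorem sum_integral_equivocation_le (h : SeparatedMixture K lam p φ T f)
    (hg : ∀ i, Integrable (equivocation p f i)) (hφ : Integrable fun w => φ w * log (φ w))
    {t : ℝ} (ht : t = ∫ w in (closedBall 0 lam)ᶜ, φ w) (s : Finset ι) :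
    ∑ j ∈ s, ∫ z, equivocation p f j z ≤
      t * (1 - ∫ w, φ w * log (φ w)) + √t * (√(Module.finrank ℝ E) +
        (log (((K : ℝ) ^ 2) ^ Module.finrank ℝ E * (φ 0 + (3 / lam) ^ Module.finrank ℝ E *
          (volume.real (closedBall (0 : E) 1))⁻¹)) * √t +
        Module.finrank ℝ E * √(∫ w in (closedBall 0 lam)ᶜ,
          φ w * log (1 + (K : ℝ) ^ 2 + ((K : ℝ) ^ 2) ^ 2 * ‖w‖ / lam) ^ 2))) := by
  have ht0 : 0 ≤ t := ht ▸ integral_nonneg h.radial.nonneg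
  have hball : ∫ w in closedBall 0 lam, φ w = 1 - t := by
    rw [ht, ← h.integral_base, ← integral_add_compl measurableSet_closedBall h.integrable_base]
    ring
  have hfin : ∀ s : Finset ι, ∑ j ∈ s, ∫ z, equivocation p f j z ≤
      1 - (∑ j ∈ s, p j) * (1 - t) + (t * (- ∫ w, φ w * log (φ w)) + √t * (√(Module.finrank ℝ E) +
        (log (((K : ℝ) ^ 2) ^ Module.finrank ℝ E * (φ 0 + (3 / lam) ^ Module.finrank ℝ E *
          (volume.real (closedBall (0 : E) 1))⁻¹)) * √t +
        Module.finrank ℝ E * √(∫ w in (closedBall 0 lam)ᶜ,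
          φ w * log (1 + (K : ℝ) ^ 2 + ((K : ℝ) ^ 2) ^ 2 * ‖w‖ / lam) ^ 2)))) := by
    intro s
    have h1 := h.sum_setIntegral_equivocation_le hg s
    have h2 := h.sum_setIntegral_compl_equivocation_le hg hφ s
    have h3 : ∑ j ∈ s, ∫ z, equivocation p f j z =
        (∑ j ∈ s, ∫ z in T j '' closedBall 0 lam, equivocation p f j z) +
          ∑ j ∈ s, ∫ z in (T j '' closedBall 0 lam)ᶜ, equivocation p f j z := by
      rw [← Finset.sum_add_distrib]
      exact Finset.sum_congr rfl fun j _ => (integral_add_compl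
        ((T j).measurableEmbedding.measurableSet_image.2 measurableSet_closedBall) (hg j)).symm
    have h4 := h.radial.neg_setIntegral_mul_log_le volume h.measurable_base h.integral_base hφ
      (measurableSet_closedBall (x := (0 : E)) (ε := lam)).compl
    have h5 := integral_mul_le_sqrt_mul_sqrt (μ := volume.restrict (closedBall (0 : E) lam)ᶜ)
      (L := fun w => log (1 + (K : ℝ) ^ 2 + ((K : ℝ) ^ 2) ^ 2 * ‖w‖ / lam))
      h.radial.nonneg h.measurable_base (by fun_prop) h.integrable_base.integrableOn
      (h.integrable_base_mul_log_sq hφ).integrableOn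
    rw [hball] at h1
    rw [← ht] at h2 h4 h5
    have h6 := mul_le_mul_of_nonneg_left h5 (Nat.cast_nonneg (α := ℝ) (Module.finrank ℝ E))
    have h7 := Real.mul_self_sqrt ht0
    linear_combination h3 + h1 + h2 + h4 + h6 - log (((K : ℝ) ^ 2) ^ Module.finrank ℝ E *
      (φ 0 + (3 / lam) ^ Module.finrank ℝ E * (volume.real (closedBall (0 : E) 1))⁻¹)) * h7
  have hlim := ((Filter.Tendsto.mul_const (1 - t) h.hasSum_p).const_sub 1).add_const
    (t * (- ∫ w, φ w * log (φ w)) + √t * (√(Module.finrank ℝ E) +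
        (log (((K : ℝ) ^ 2) ^ Module.finrank ℝ E * (φ 0 + (3 / lam) ^ Module.finrank ℝ E *
          (volume.real (closedBall (0 : E) 1))⁻¹)) * √t +
        Module.finrank ℝ E * √(∫ w in (closedBall 0 lam)ᶜ,
          φ w * log (1 + (K : ℝ) ^ 2 + ((K : ℝ) ^ 2) ^ 2 * ‖w‖ / lam) ^ 2))))
  refine (ge_of_tendsto hlim ?_).trans_eq (by ring)
  filter_upwards [Filter.eventually_ge_atTop s] with s' hs'
  refine (Finset.sum_le_sum_of_subset_of_nonneg hs' fun j _ _ => ?_).trans (hfin s')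
  exact integral_nonneg_of_ae (by filter_upwards [h.ae_equivocation_nonneg] with z hz using hz j)

theorem hasSum_integral_mul_log_mixture (h : SeparatedMixture K lam p φ T f)
    (hent : Integrable fun z => mixture p f z * log (mixture p f z)) :
    HasSum (fun j => ∫ z, p j * f j z * log (mixture p f z))
      (∫ z, mixture p f z * log (mixture p f z)) := by
  have hi := h.integrable_mul_log_mixture hent
  have key := hasSum_integral_of_summable_integral_norm hi
    (summable_of_sum_le (c := ∫ z, ‖mixture p f z * log (mixture p f z)‖)
      (fun j => integral_nonneg fun z => norm_nonneg (p j * f j z * log (mixture p f z)))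
      fun s => ?_)
  · have e : ∫ z, mixture p f z * log (mixture p f z) =
        ∫ z, ∑' j, p j * f j z * log (mixture p f z) := integral_congr_ae (by
      filter_upwards [h.ae_hasSum] with z hz
      exact (hz.mul_right _).tsum_eq.symm)
    rwa [e]
  · rw [← integral_finsetSum _ fun j _ => (hi j).norm]
    refine integral_mono_ae (integrable_finsetSum _ fun j _ => (hi j).norm) hent.norm ?_
    filter_upwards [h.ae_hasSum] with z hz
    simp_rw [norm_mul (p _ * _), norm_mul (mixture p f z), ← Finset.sum_mul]
    refine mul_le_mul_of_nonneg_right ?_ (norm_nonneg (log (mixture p f z)))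
    simp_rw [Real.norm_of_nonneg (h.mixture_nonneg z),
      Real.norm_of_nonneg (mul_nonneg (h.p_nonneg _) (h.nonneg _ z))]
    exact sum_le_hasSum s (fun j _ => mul_nonneg (h.p_nonneg j) (h.nonneg j z)) hz

/-- The mutual information between label and mixture is at least the entropy of the label minus
any bound on the equivocation. -/
theorem le_entropy_sub (h : SeparatedMixture K lam p φ T f)
    (hent : Integrable fun z => mixture p f z * log (mixture p f z))
    (hent' : ∀ i, Integrable fun z => f i z * log (f i z))
    (hsum : Summable fun i => p i * ∫ z, f i z * log (f i z)) {C : ℝ}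
    (hC : ∀ s : Finset ι, ∑ j ∈ s, ∫ z, equivocation p f j z ≤ C) :
    (- ∑' i, p i * log (p i)) - C ≤ (- ∫ z, mixture p f z * log (mixture p f z)) -
      ∑' i, p i * (- ∫ z, f i z * log (f i z)) := by
  have hG : Summable fun j => ∫ z, equivocation p f j z :=
    summable_of_sum_le (fun j => integral_nonneg_of_ae (by
      filter_upwards [h.ae_equivocation_nonneg] with z hz using hz j)) hC
  have hF := h.hasSum_integral_mul_log_mixture hent
  have e : ∀ j, ∫ z, equivocation p f j z = (∫ z, p j * f j z * log (mixture p f z)) -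
      p j * (∫ z, f j z * log (f j z)) - p j * log (p j) := fun j => by
    have i1 : Integrable fun z => p j * f j z * log (mixture p f z) -
        p j * (f j z * log (f j z)) :=
      (h.integrable_mul_log_mixture hent j).sub ((hent' j).const_mul _)
    rw [integral_congr_ae (by filter_upwards [h.ae_equivocation_eq] with z hz using hz j),
      integral_sub i1 ((h.integrable j).const_mul _),
      integral_sub (h.integrable_mul_log_mixture hent j) ((hent' j).const_mul _),
      integral_const_mul, integral_const_mul, h.integral_eq_one, mul_one]
  have hp : HasSum (fun j => p j * log (p j)) _ :=
    ((hF.sub hsum.hasSum).sub hG.hasSum).congr_fun fun j => by rw [e]; ring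
  have hle := hG.tsum_le_of_sum_le hC
  rw [hp.tsum_eq]
  simp_rw [mul_neg, tsum_neg]
  linarith

end SeparatedMixture

end Mixture

/-- Theorem 1.2 (lower bound on the concavity deficit / Fano sharpening): `X` takes countably
many values with probabilities `p i`; given `X = i`, `Z` is distributed as `T i W`, where `W`
has a spherically symmetric log-concave density `φ` on `ℝ^d` and each `T i` is a `√τ`
bi-Lipschitz bijection with `τ ≥ 1`; writing `T_{ij} = (T i)⁻¹ ∘ T j`, the sets
`T_{ij} '' B_lam` and `T_{kj} '' B_lam` are disjoint for `k ≠ i`.  Then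
`h(Z) - h(Z|X) ≥ H(X) - C̃(W)` where, with `𝒯 = ℙ(|W| > lam)`,
`C̃(W) = 𝒯*(1 + h(W)) + 𝒯^{1/2}*(√d + K(φ))` and
`K(φ) = log (τ^d * (‖φ‖_∞ + (3/lam)^d * ω_d⁻¹)) * 𝒯^{1/2}
        + d * (∫_{|w|>lam} φ w * log²(1 + τ + τ²|w|/lam) dw)^{1/2}`. -/
theorem fano_sharpening
    {d : ℕ} {ι : Type*} [Countable ι]
    (τ lam : ℝ) (hτ : 1 ≤ τ) (hlam : 0 < lam)
    (p : ι → ℝ) (hp0 : ∀ i, 0 ≤ p i) (hp1 : ∑' i, p i = 1)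
    (φ : EuclideanSpace ℝ (Fin d) → ℝ) (ψ : ℝ → ℝ)
    (hφψ : ∀ x, φ x = ψ ‖x‖)
    (hφ0 : ∀ x, 0 ≤ φ x) (hφmeas : Measurable φ) (hφ1 : ∫ x, φ x = 1)
    (hφlc : ∀ x y : EuclideanSpace ℝ (Fin d), ∀ s ∈ Set.Icc (0 : ℝ) 1,
      φ x ^ (1 - s) * φ y ^ s ≤ φ ((1 - s) • x + s • y))
    (T : ι → EuclideanSpace ℝ (Fin d) → EuclideanSpace ℝ (Fin d))
    (hbij : ∀ i, Function.Bijective (T i))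
    (hlip : ∀ i x y, (1 / Real.sqrt τ) * dist x y ≤ dist (T i x) (T i y) ∧
                      dist (T i x) (T i y) ≤ Real.sqrt τ * dist x y)
    -- `f i` is the density of `T i W`, i.e. the conditional density of `Z` given `X = i`
    (f : ι → EuclideanSpace ℝ (Fin d) → ℝ)
    (hf0 : ∀ i z, 0 ≤ f i z) (hfmeas : ∀ i, Measurable (f i))
    (hfdens : ∀ i, ∀ A : Set (EuclideanSpace ℝ (Fin d)), MeasurableSet A →
      ∫ z in A, f i z = ∫ w in (T i) ⁻¹' A, φ w)
    (Tij : ι → ι → EuclideanSpace ℝ (Fin d) → EuclideanSpace ℝ (Fin d))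
    (hTij : ∀ i j, Tij i j = Function.invFun (T i) ∘ T j)
    (hsep : ∀ i j k, k ≠ i →
      Disjoint (Tij i j '' closedBall 0 lam) (Tij k j '' closedBall 0 lam))
    (fmix : EuclideanSpace ℝ (Fin d) → ℝ) (hfmix : ∀ z, fmix z = ∑' i, p i * f i z)
    (𝒯 : ℝ) (h𝒯 : 𝒯 = ∫ w in {w : EuclideanSpace ℝ (Fin d) | lam < ‖w‖}, φ w)
    (K Ctil : ℝ)
    (hK : K = Real.log (τ ^ d * ((⨆ x, φ x)
            + (3 / lam) ^ d
              * ((volume (closedBall (0 : EuclideanSpace ℝ (Fin d)) 1)).toReal)⁻¹))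
            * Real.sqrt 𝒯
          + (d : ℝ) * Real.sqrt (∫ w in {w : EuclideanSpace ℝ (Fin d) | lam < ‖w‖},
              φ w * (Real.log (1 + τ + τ ^ 2 * ‖w‖ / lam)) ^ 2))
    (hCtil : Ctil = 𝒯 * (1 + (- ∫ w, φ w * Real.log (φ w)))
          + Real.sqrt 𝒯 * (Real.sqrt d + K))
    -- integrability and summability assumptions making the entropies well defined
    (hmixent : Integrable (fun z => fmix z * Real.log (fmix z)))
    (hient : ∀ i, Integrable (fun z => f i z * Real.log (f i z)))
    (hsument : Summable (fun i => p i * ∫ z, f i z * Real.log (f i z)))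
    (hφent : Integrable (fun w => φ w * Real.log (φ w))) :
    (- ∫ z, fmix z * Real.log (fmix z)) - ∑' i, p i * (- ∫ z, f i z * Real.log (f i z))
      ≥ (- ∑' i, p i * Real.log (p i)) - Ctil := by
  have hτ0 : 0 < √τ := Real.sqrt_pos.2 (one_pos.trans_le hτ)
  have hrad : RadialLogConcave φ :=
    ⟨hφ0, fun x y hxy => by rw [hφψ, hφψ, hxy], hφlc⟩
  let Te : ι → EuclideanSpace ℝ (Fin d) ≃ EuclideanSpace ℝ (Fin d) := fun i =>
    Equiv.ofBijective (T i) (hbij i)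
  have hTe : ∀ i x, Te i x = T i x := fun _ _ => rfl
  have hl : ∀ i, LipschitzWith (NNReal.sqrt τ.toNNReal) (Te i) := fun i =>
    LipschitzWith.of_dist_le_mul fun x y => by
      simpa [hTe, Real.coe_sqrt, Real.coe_toNNReal τ (by linarith)] using (hlip i x y).2
  have hl' : ∀ i, LipschitzWith (NNReal.sqrt τ.toNNReal) (Te i).symm := fun i =>
    LipschitzWith.of_dist_le_mul fun x y => by
      have := (hlip i ((Te i).symm x) ((Te i).symm y)).1
      rw [← hTe, ← hTe, Equiv.apply_symm_apply, Equiv.apply_symm_apply, one_div,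
        inv_mul_le_iff₀ hτ0] at this
      simpa [Real.coe_sqrt, Real.coe_toNNReal τ (by linarith)] using this
  let Th : ι → EuclideanSpace ℝ (Fin d) ≃ₜ EuclideanSpace ℝ (Fin d) := fun i =>
    ⟨Te i, (hl i).continuous, (hl' i).continuous⟩
  have hinv : ∀ i, Function.LeftInverse (Function.invFun (T i)) (T i) := fun i =>
    Function.leftInverse_invFun (hbij i).1
  have hφi : Integrable φ := Integrable.of_integral_ne_zero (by simp [hφ1])
  have h : SeparatedMixture (NNReal.sqrt τ.toNNReal) lam p φ Th f :=
    { one_le := by simpa using hτ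
      lam_pos := hlam
      p_nonneg := hp0
      hasSum_p := hp1 ▸ (by_contra fun hs => by simp [tsum_eq_zero_of_not_summable hs] at hp1 : Summable p).hasSum
      radial := hrad
      measurable_base := hφmeas
      integral_base := hφ1
      lipschitz := hl
      lipschitz_symm := hl'
      disjoint := fun i j hij => by
        have := hsep i j j hij.symm
        rw [hTij, hTij] at this
        refine disjoint_left.2 ?_
        rintro _ ⟨u, hu, rfl⟩ ⟨v, hv, hvu⟩
        refine disjoint_left.1 this ⟨v, hv, ?_⟩ ⟨u, hu, hinv j u⟩
        exact (congrArg (Function.invFun (T i)) hvu).trans (hinv i u)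
      nonneg := hf0
      measurable := hfmeas
      law := fun i A hA => by
        have hfi : Integrable (f i) := Integrable.of_integral_ne_zero (by
          have := hfdens i univ MeasurableSet.univ
          simp at this
          simp [this, hφ1])
        rw [← ofReal_integral_eq_lintegral_ofReal hfi.integrableOn
            (Filter.Eventually.of_forall (hf0 i)),
          ← ofReal_integral_eq_lintegral_ofReal hφi.integrableOn
            (Filter.Eventually.of_forall hφ0), hfdens i A hA]
        rfl }
  obtain rfl : fmix = mixture p f := funext hfmix
  refine h.le_entropy_sub hmixent hient hsument fun s => ?_
  have hset : {w : EuclideanSpace ℝ (Fin d) | lam < ‖w‖} = (closedBall 0 lam)ᶜ := by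
    ext w; simp
  have hsup : ⨆ x, φ x = φ 0 := le_antisymm (ciSup_le fun x => hrad.antitone (by simp))
    (le_ciSup (f := φ) ⟨φ 0, by rintro _ ⟨x, rfl⟩; exact hrad.antitone (by simp)⟩ 0)
  have hτK : ((NNReal.sqrt τ.toNNReal : NNReal) : ℝ) ^ 2 = τ := by
    rw [Real.coe_sqrt, Real.coe_toNNReal τ (by linarith), Real.sq_sqrt (by linarith)]
  have := h.sum_integral_equivocation_le (h.integrable_equivocation hmixent hient) hφent
    (h𝒯.trans (by rw [hset])) s
  rw [hτK, finrank_euclideanSpace_fin] at this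
  rw [hCtil, hK, hset, hsup, ← sub_eq_add_neg]
  exact this
end

section
/- Let d ≥ 2 and let φ_σ(w) = e^{−|w|²/(2σ²)}/(2πσ²)^{d/2} be the centered Gaussian density on ℝ^d with covariance σ²·Id, and let W ~ φ_σ. Then for every λ > 0, the entropy tail satisfies −∫_{|w| > λ} φ_σ(w) log φ_σ(w) dw ≤ ( (d/2)·log(2πe²σ²) + λ²/σ² ) · ℙ(|W| > λ). -/
open MeasureTheory Real

lemma integrable_pow_mul_exp_neg_mul_sq {a : ℝ} (ha : 0 < a) (k : ℕ) :
    Integrable fun r : ℝ => r ^ k * Real.exp (-a * r ^ 2) := by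
  have h := integrable_rpow_mul_exp_neg_mul_sq ha (s := (k : ℝ))
    (by linarith [k.cast_nonneg (α := ℝ)])
  simpa only [Real.rpow_natCast] using h

/-- Truncated radial moments of a Gaussian on `ℝ^(n+2)`. -/
lemma integral_Ioi_radial_gaussian_nonpos {a lam : ℝ} (ha : 0 < a) (hlam : 0 < lam) (n : ℕ) :
    ∫ r in Set.Ioi lam, r ^ (n + 1) *
      ((a * r ^ 2 - (n + 2) - 2 * a * lam ^ 2) * Real.exp (-a * r ^ 2)) ≤ 0 := by
  have hI := integrable_pow_mul_exp_neg_mul_sq ha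
  set h : ℝ → ℝ := fun r => -(r ^ 2 - lam ^ 2) * r ^ n * Real.exp (-a * r ^ 2) / 2
  set h' : ℝ → ℝ := fun r => (-(2 * r) * r ^ n - (r ^ 2 - lam ^ 2) * (n * r ^ (n - 1))
    + 2 * a * r * (r ^ 2 - lam ^ 2) * r ^ n) * Real.exp (-a * r ^ 2) / 2 with hh'
  have hderiv : ∀ r, HasDerivAt h (h' r) r := by
    intro r
    have h1 : HasDerivAt (fun r : ℝ => -(r ^ 2 - lam ^ 2)) (-(2 * r)) r := by
      simpa using ((hasDerivAt_pow 2 r).sub_const (lam ^ 2)).fun_neg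
    have h2 : HasDerivAt (fun r : ℝ => Real.exp (-a * r ^ 2))
        (Real.exp (-a * r ^ 2) * (-a * (2 * r))) r := by
      simpa using ((hasDerivAt_pow 2 r).const_mul (-a)).exp
    refine (((h1.mul (hasDerivAt_pow n r)).mul h2).div_const 2).congr_deriv ?_
    simp only [hh', Pi.mul_apply]
    ring
  have hint : Integrable h := by
    refine ((((hI n).const_mul (lam ^ 2)).sub (hI (n + 2))).div_const 2).congr
      (Filter.Eventually.of_forall fun r => ?_)
    simp only [h, Pi.sub_apply]
    ring
  have hint' : Integrable h' := by
    refine (((((hI (n + 1)).const_mul (-2)).sub ((hI (n - 1 + 2)).const_mul n)).add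
      ((hI (n - 1)).const_mul (n * lam ^ 2))).add
      (((hI (n + 3)).sub ((hI (n + 1)).const_mul (lam ^ 2))).const_mul (2 * a))).div_const 2
      |>.congr (Filter.Eventually.of_forall fun r => ?_)
    simp only [h', Pi.sub_apply, Pi.add_apply]
    ring
  have hlim := tendsto_zero_of_hasDerivAt_of_integrableOn_Ioi (a := lam)
    (fun r _ => hderiv r) hint'.integrableOn hint.integrableOn
  have hzero : ∫ r in Set.Ioi lam, h' r = 0 := by
    rw [integral_Ioi_of_hasDerivAt_of_tendsto' (fun r _ => hderiv r) hint'.integrableOn hlim]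
    simp [h]
  rw [← hzero]
  refine setIntegral_mono_on ?_ hint'.integrableOn measurableSet_Ioi fun r hr => ?_
  · refine Integrable.integrableOn ((((hI (n + 3)).const_mul a).sub
      ((hI (n + 1)).const_mul (n + 2 + 2 * a * lam ^ 2))).congr
      (Filter.Eventually.of_forall fun r => ?_))
    simp only [Pi.sub_apply]
    ring
  · have hr0 : 0 < r := hlam.trans hr
    have hpow : (n : ℝ) * r ^ (n - 1) * r = n * r ^ n := by
      cases n with
      | zero => simp
      | succ m => simp only [Nat.add_sub_cancel]; ring
    have hdiff : h' r - r ^ (n + 1) * ((a * r ^ 2 - (n + 2) - 2 * a * lam ^ 2)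
        * Real.exp (-a * r ^ 2)) = ((n + 2) * r ^ (n + 1) / 2 + a * lam ^ 2 * r ^ (n + 1)
          + lam ^ 2 * (n * r ^ (n - 1)) / 2) * Real.exp (-a * r ^ 2) := by
      simp only [h']
      linear_combination (-r * Real.exp (-a * r ^ 2) / 2) * hpow
    have : 0 ≤ ((n + 2) * r ^ (n + 1) / 2 + a * lam ^ 2 * r ^ (n + 1)
          + lam ^ 2 * (n * r ^ (n - 1)) / 2) * Real.exp (-a * r ^ 2) := by positivity
    linarith

lemma setIntegral_lt_norm_fun_norm {d : ℕ} (hd : 0 < d) {lam : ℝ} (hlam : 0 < lam) (g : ℝ → ℝ) :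
    ∫ w in {w : EuclideanSpace ℝ (Fin d) | lam < ‖w‖}, g ‖w‖ =
      (d * volume.real (Metric.ball (0 : EuclideanSpace ℝ (Fin d)) 1)) *
        ∫ r in Set.Ioi lam, r ^ (d - 1) * g r := by
  have : Nonempty (Fin d) := ⟨⟨0, hd⟩⟩
  have hmeas : MeasurableSet {w : EuclideanSpace ℝ (Fin d) | lam < ‖w‖} :=
    measurableSet_lt measurable_const measurable_norm
  rw [← integral_indicator hmeas]
  have h := integral_fun_norm_addHaar (volume : Measure (EuclideanSpace ℝ (Fin d)))
    ((Set.Ioi lam).indicator g)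
  have hset : ∫ r in Set.Ioi (0 : ℝ), r ^ (d - 1) * (Set.Ioi lam).indicator g r
      = ∫ r in Set.Ioi lam, r ^ (d - 1) * g r := by
    simp_rw [← Set.indicator_mul_right (Set.Ioi lam) (fun r : ℝ => r ^ (d - 1)) g]
    rw [setIntegral_indicator measurableSet_Ioi,
      Set.inter_eq_right.2 (Set.Ioi_subset_Ioi hlam.le)]
  simp only [finrank_euclideanSpace, Fintype.card_fin, smul_eq_mul, nsmul_eq_mul, hset] at h
  rw [← mul_assoc] at h
  exact h

/-- Proposition B.1 (Gaussian entropy tail bound): for `d ≥ 2`, `σ > 0`, let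
`φ_σ(w) = exp(-|w|²/(2σ²)) / (2πσ²)^{d/2}` be the centered isotropic Gaussian density on `ℝ^d`.
Then for every `lam > 0`,
`-∫_{|w|>lam} φ_σ log φ_σ ≤ ((d/2) log (2π e² σ²) + lam²/σ²) * ℙ(|W| > lam)`. -/
theorem gaussian_entropy_tail_bound
    {d : ℕ} (hd : 2 ≤ d) (σ lam : ℝ) (hσ : 0 < σ) (hlam : 0 < lam)
    (φ : EuclideanSpace ℝ (Fin d) → ℝ)
    (hφ : ∀ w, φ w = Real.exp (-‖w‖ ^ 2 / (2 * σ ^ 2)) / (2 * Real.pi * σ ^ 2) ^ ((d : ℝ) / 2)) :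
    - ∫ w in {w : EuclideanSpace ℝ (Fin d) | lam < ‖w‖}, φ w * Real.log (φ w)
      ≤ ((d : ℝ) / 2 * Real.log (2 * Real.pi * Real.exp 1 ^ 2 * σ ^ 2) + lam ^ 2 / σ ^ 2)
          * ∫ w in {w : EuclideanSpace ℝ (Fin d) | lam < ‖w‖}, φ w := by
  obtain ⟨n, rfl⟩ := Nat.exists_eq_add_of_le' hd
  set a : ℝ := 1 / (2 * σ ^ 2) with ha_def
  have ha : 0 < a := by positivity
  set L : ℝ := ((n + 2 : ℕ) : ℝ) / 2 * Real.log (2 * Real.pi * σ ^ 2) with hL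
  set Z : ℝ := (2 * Real.pi * σ ^ 2) ^ (((n + 2 : ℕ) : ℝ) / 2)
  have hpos : 0 < 2 * Real.pi * σ ^ 2 := by positivity
  have hZ : 0 < Z := Real.rpow_pos_of_pos hpos _
  have hlogZ : Real.log Z = L := Real.log_rpow hpos _
  have hK : ((n + 2 : ℕ) : ℝ) / 2 * Real.log (2 * Real.pi * Real.exp 1 ^ 2 * σ ^ 2)
      + lam ^ 2 / σ ^ 2 = L + (n + 2) + 2 * a * lam ^ 2 := by
    have h1 : 2 * Real.pi * Real.exp 1 ^ 2 * σ ^ 2 = (2 * Real.pi * σ ^ 2) * Real.exp 1 ^ 2 := by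
      ring
    rw [h1, Real.log_mul hpos.ne' (by positivity), Real.log_pow, Real.log_exp, hL, ha_def]
    push_cast
    field_simp
  have hφ' : ∀ w, φ w = Real.exp (-a * ‖w‖ ^ 2) / Z := by
    intro w
    rw [hφ, ha_def]
    congr 2
    ring
  have hlog : ∀ w, φ w * Real.log (φ w) =
      Real.exp (-a * ‖w‖ ^ 2) / Z * (-a * ‖w‖ ^ 2 - L) := by
    intro w
    rw [hφ', Real.log_div (Real.exp_pos _).ne' hZ.ne', Real.log_exp, hlogZ]
  have hI := integrable_pow_mul_exp_neg_mul_sq ha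
  simp_rw [hlog, hφ']
  rw [hK, setIntegral_lt_norm_fun_norm (by lia) hlam
      (fun r => Real.exp (-a * r ^ 2) / Z * (-a * r ^ 2 - L)),
    setIntegral_lt_norm_fun_norm (by lia) hlam (fun r => Real.exp (-a * r ^ 2) / Z)]
  simp only [show n + 2 - 1 = n + 1 by lia]
  have hi1 : Integrable fun r : ℝ =>
      r ^ (n + 1) * (Real.exp (-a * r ^ 2) / Z * (-a * r ^ 2 - L)) := by
    refine ((((hI (n + 3)).const_mul (-a)).sub ((hI (n + 1)).const_mul L)).div_const Z).congr
      (Filter.Eventually.of_forall fun r => ?_)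
    simp only [Pi.sub_apply]
    ring
  have hi2 : Integrable fun r : ℝ => r ^ (n + 1) * (Real.exp (-a * r ^ 2) / Z) := by
    refine ((hI (n + 1)).div_const Z).congr (Filter.Eventually.of_forall fun r => ?_)
    ring
  have key : -(∫ r in Set.Ioi lam, r ^ (n + 1) * (Real.exp (-a * r ^ 2) / Z * (-a * r ^ 2 - L)))
      - (L + (n + 2) + 2 * a * lam ^ 2) *
        ∫ r in Set.Ioi lam, r ^ (n + 1) * (Real.exp (-a * r ^ 2) / Z) ≤ 0 := by
    rw [← integral_neg, ← integral_const_mul, ← integral_sub hi1.integrableOn.fun_neg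
      (hi2.integrableOn.const_mul _)]
    calc _ = (∫ r in Set.Ioi lam, r ^ (n + 1) *
          ((a * r ^ 2 - (n + 2) - 2 * a * lam ^ 2) * Real.exp (-a * r ^ 2))) / Z := by
          rw [← integral_div]
          congr 1
          ext r
          ring
      _ ≤ 0 := div_nonpos_of_nonpos_of_nonneg
          (integral_Ioi_radial_gaussian_nonpos ha hlam n) hZ.le
  have hC : 0 ≤ ((n + 2 : ℕ) : ℝ) *
      volume.real (Metric.ball (0 : EuclideanSpace ℝ (Fin (n + 2))) 1) := by positivity
  linarith [mul_nonpos_of_nonneg_of_nonpos hC key]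
end
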